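/- arXiv:math/9205209 — 4 statements merged into one kernel-verified Lean document; each statement's English description precedes it below -/
import Mathlib

section
/- Let d ≥ 1 and let f₀ : [0,1] → [0,1] be a continuous map carrying the boundary points 0 and 1 to boundary points (f₀({0,1}) ⊆ {0,1}) which is piecewise monotone with exactly d alternately ascending and descending laps, i.e. there are points 0 = a₀ < a₁ < ⋯ < a_d = 1 such that f₀ is strictly monotone on each interval [a_{i-1}, a_i] and the directions of monotonicity alternate. Then there is one and only one orientation-preserving homeomorphism h₀ : [0,1] → [0,1] (a continuous strictly increasing bijection with h₀(0) = 0 and h₀(1) = 1) such that the composition f₀ ∘ h₀ is the restriction to [0,1] of a real polynomial of degree d. -/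
open Set

namespace ThurstonStep

open Polynomial Filter Topology

variable {d : ℕ}

/-- polynomial with given coefficients -/
noncomputable def P (c : Fin (d + 1) → ℝ) : ℝ[X] := ∑ k : Fin (d + 1), C (c k) * X ^ (k : ℕ)

lemma P_add (c r : Fin (d + 1) → ℝ) : P (c + r) = P c + P r := by
  simp [P, add_mul, Finset.sum_add_distrib]

lemma P_smul (t : ℝ) (r : Fin (d + 1) → ℝ) : P (t • r) = C t * P r := by
  simp [P, Finset.mul_sum, mul_assoc]

lemma P_natDegree (c : Fin (d + 1) → ℝ) : (P c).natDegree ≤ d := by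
  apply natDegree_sum_le_of_forall_le
  intro k _
  exact (natDegree_C_mul_X_pow_le _ _).trans (by omega)

lemma P_coeff (c : Fin (d + 1) → ℝ) (k : Fin (d + 1)) : (P c).coeff k = c k := by
  simp [P, coeff_X_pow, Fin.val_inj]

lemma P_inj {c r : Fin (d + 1) → ℝ} (h : P c = P r) : c = r := by
  ext k
  rw [← P_coeff c, ← P_coeff r, h]

lemma P_of (p : ℝ[X]) (hp : p.natDegree ≤ d) : P (fun k : Fin (d + 1) => p.coeff k) = p := by
  conv_rhs => rw [p.as_sum_range_C_mul_X_pow' (n := d + 1) (by omega)]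
  rw [P, Finset.sum_range]

lemma P_eval (c : Fin (d + 1) → ℝ) (t : ℝ) : (P c).eval t = ∑ k, c k * t ^ (k : ℕ) := by
  simp [P, eval_finsetSum]

lemma P_deriv_eval (c : Fin (d + 1) → ℝ) (t : ℝ) :
    (derivative (P c)).eval t = ∑ k : Fin (d + 1), c k * ((k : ℕ) * t ^ ((k : ℕ) - 1)) := by
  simp [P, eval_finsetSum, derivative_X_pow]

lemma eq_zero_of_nodes {q : ℝ[X]} {x : Fin (d + 1) → ℝ} (hx : Function.Injective x)
    (hq : q.natDegree ≤ d) (h : ∀ i, q.eval (x i) = 0) : q = 0 := by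
  apply eq_zero_of_natDegree_lt_card_of_eval_eq_zero q hx h
  simp; omega

/-- inner nodes -/
def inner (d : ℕ) : Finset (Fin (d + 1)) := {i | i ≠ 0 ∧ i ≠ Fin.last d}

lemma inner_card (hd : 1 ≤ d) : (inner d).card + 1 = d := by
  have : inner d = (Finset.univ.erase 0).erase (Fin.last d) := by
    ext i; simp [inner, and_comm]
  rw [this, Finset.card_erase_of_mem, Finset.card_erase_of_mem]
  · simp; omega
  · simp
  · simp [Fin.ext_iff]; omega

lemma crit_ne (hd : 1 ≤ d) {q : ℝ[X]} {x : Fin (d + 1) → ℝ} (hx : Function.Injective x)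
    (hq : q.natDegree + 1 ≤ d) (h0 : q ≠ 0)
    (h : ∀ i ∈ inner d, q.eval (x i) = 0) (t : ℝ) (ht : ∀ i ∈ inner d, t ≠ x i) :
    q.eval t ≠ 0 := by
  intro hqt
  apply h0
  apply eq_zero_of_natDegree_lt_card_of_eval_eq_zero' q (insert t ((inner d).image x))
  · intro y hy
    rw [Finset.mem_insert, Finset.mem_image] at hy
    rcases hy with rfl | ⟨i, hi, rfl⟩
    · exact hqt
    · exact h i hi
  · rw [Finset.card_insert_of_notMem, Finset.card_image_of_injective _ hx, inner_card hd]
    · omega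
    · intro hy
      rw [Finset.mem_image] at hy
      obtain ⟨i, hi, e⟩ := hy
      exact ht i hi e.symm

lemma crit_simple (hd : 1 ≤ d) {q : ℝ[X]} {x : Fin (d + 1) → ℝ} (hx : Function.Injective x)
    (hq : q.natDegree + 1 ≤ d) (h0 : q ≠ 0)
    (h : ∀ i ∈ inner d, q.eval (x i) = 0) (i : Fin (d + 1)) (hi : i ∈ inner d) :
    (derivative q).eval (x i) ≠ 0 := by
  intro hqt
  have hdv : (X - C (x i)) ∣ q := dvd_iff_isRoot.2 (h i hi)
  obtain ⟨r, rfl⟩ := hdv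
  have hr0 : r ≠ 0 := right_ne_zero_of_mul h0
  have hri : r.eval (x i) = 0 := by simpa using hqt
  apply hr0
  apply eq_zero_of_natDegree_lt_card_of_eval_eq_zero' r ((inner d).image x)
  · intro y hy
    rw [Finset.mem_image] at hy
    obtain ⟨j, hj, rfl⟩ := hy
    by_cases hji : j = i
    · rw [hji]; exact hri
    · have := h j hj
      rw [eval_mul] at this
      rcases mul_eq_zero.1 this with h1 | h1
      · exfalso; apply hji; apply hx; simpa [sub_eq_zero] using h1
      · exact h1
  · rw [Finset.card_image_of_injective _ hx]
    rw [natDegree_mul (X_sub_C_ne_zero _) hr0, natDegree_X_sub_C] at hq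
    have := inner_card hd
    omega

/-- the alternating values -/
def V (d : ℕ) (s : ℝ) : Set (Fin (d + 1) → ℝ) :=
  {v | ∀ i : Fin d, 0 < s * (-1) ^ (i : ℕ) * (v i.succ - v i.castSucc)}

abbrev E (d : ℕ) := (Fin (d + 1) → ℝ) × (Fin (d + 1) → ℝ)

/-- the solutions -/
structure Sol (v : Fin (d + 1) → ℝ) (z : E d) : Prop where
  mono : StrictMono z.2
  zero : z.2 0 = 0
  last : z.2 (Fin.last d) = 1
  val : ∀ i, (P z.1).eval (z.2 i) = v i
  crit : ∀ i ∈ inner d, (derivative (P z.1)).eval (z.2 i) = 0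

noncomputable def G (z : E d) : E d :=
  (fun i => (P z.1).eval (z.2 i),
   fun i => if i = 0 then z.2 i else if i = Fin.last d then z.2 i - 1 else
    (derivative (P z.1)).eval (z.2 i))

lemma sol_iff (hd : 1 ≤ d) (v : Fin (d + 1) → ℝ) (z : E d) :
    Sol v z ↔ StrictMono z.2 ∧ G z = (v, 0) := by
  have hl : Fin.last d ≠ 0 := by simp [Fin.ext_iff]; omega
  constructor
  · intro h
    refine ⟨h.mono, ?_⟩
    ext i
    · exact h.val i
    · simp only [G, Pi.zero_apply]
      split_ifs with h1 h2
      · rw [h1, h.zero]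
      · rw [h2, h.last]; simp
      · exact h.crit i (by simp [inner, h1, h2])
  · rintro ⟨hm, hG⟩
    have h1 := congrArg Prod.fst hG
    have h2 := congrArg Prod.snd hG
    refine ⟨hm, ?_, ?_, fun i => congrFun h1 i, ?_⟩
    · simpa [G] using congrFun h2 0
    · have := congrFun h2 (Fin.last d)
      simp [G, hl] at this
      linarith
    · intro i hi
      have := congrFun h2 i
      simp [inner] at hi
      simpa [G, hi.1, hi.2] using this

lemma G_contDiff : ContDiff ℝ 1 (G (d := d)) := by
  unfold G
  apply ContDiff.prodMk
  · rw [contDiff_pi]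
    intro i
    simp only [P_eval]
    fun_prop
  · rw [contDiff_pi]
    intro i
    split_ifs
    · fun_prop
    · fun_prop
    · simp only [P_deriv_eval]
      fun_prop

lemma line_deriv (p r : ℝ[X]) (x y : ℝ) :
    HasDerivAt (fun t : ℝ => (p + C t * r).eval (x + t * y))
      (r.eval x + (derivative p).eval x * y) 0 := by
  have h1 : HasDerivAt (fun t : ℝ => x + t * y) y 0 := by
    simpa using ((hasDerivAt_id (0:ℝ)).mul_const y).const_add x
  have h2 := HasDerivAt.comp (0:ℝ) (h₂ := fun s => p.eval s) (p.hasDerivAt _) h1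
  have h3 := HasDerivAt.comp (0:ℝ) (h₂ := fun s => r.eval s) (r.hasDerivAt _) h1
  have h4 := h2.add ((hasDerivAt_id (0:ℝ)).mul h3)
  have e1 : (fun t : ℝ => (p + C t * r).eval (x + t * y)) =
      ((fun s => eval s p) ∘ fun t => x + t * y) +
        id * (fun s => eval s r) ∘ fun t => x + t * y := by
    funext t; simp
  rw [e1]
  refine h4.congr_deriv ?_
  simp; ring

lemma G_line (z u : E d) (h0 : d ≠ 0) : fderiv ℝ G z u =
    (fun i => (P u.1).eval (z.2 i) + (derivative (P z.1)).eval (z.2 i) * u.2 i,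
     fun i => if i = 0 then u.2 i else if i = Fin.last d then u.2 i else
      (derivative (P u.1)).eval (z.2 i)
        + (derivative (derivative (P z.1))).eval (z.2 i) * u.2 i) := by
  have h1 : HasDerivAt (fun t : ℝ => z + t • u) u 0 := by
    simpa using ((hasDerivAt_id (0:ℝ)).smul_const u).const_add z
  have h2 : HasFDerivAt G (fderiv ℝ G z) (z + (0:ℝ) • u) := by
    simpa using (G_contDiff.differentiable (by norm_num) z).hasFDerivAt
  have h3 := h2.comp_hasDerivAt (0:ℝ) h1
  refine h3.unique ?_
  apply HasDerivAt.prodMk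
  · rw [hasDerivAt_pi]
    intro i
    have := line_deriv (P z.1) (P u.1) (z.2 i) (u.2 i)
    simpa [P_add, P_smul] using this
  · rw [hasDerivAt_pi]
    intro i
    have hl : HasDerivAt (fun t : ℝ => z.2 i + t * u.2 i) (u.2 i) 0 := by
      simpa using ((hasDerivAt_id (0:ℝ)).mul_const (u.2 i)).const_add (z.2 i)
    by_cases h1 : i = 0
    · simp [h1] at hl ⊢
      exact hl
    by_cases h2 : i = Fin.last d
    · simp [h2, h0] at hl ⊢
      exact hl
    · have := line_deriv (derivative (P z.1)) (derivative (P u.1)) (z.2 i) (u.2 i)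
      simpa [P_add, P_smul, h1, h2, derivative_mul] using this

lemma V_ne {s : ℝ} {v : Fin (d + 1) → ℝ} (hv : v ∈ V d s) (i : Fin d) :
    v i.succ ≠ v i.castSucc := by
  intro h
  have := hv i
  rw [h] at this
  simp at this

lemma deriv_ne_zero (hd : 1 ≤ d) {s : ℝ} {v : Fin (d + 1) → ℝ} (hv : v ∈ V d s) {z : E d}
    (hz : Sol v z) : derivative (P z.1) ≠ 0 := by
  intro h
  have h1 := derivative_eq_zero.1 h
  apply V_ne hv ⟨0, hd⟩
  rw [← hz.val, ← hz.val, eq_C_of_natDegree_eq_zero h1]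
  simp

lemma deriv_deg (hd : 1 ≤ d) (c : Fin (d + 1) → ℝ) : (derivative (P c)).natDegree + 1 ≤ d := by
  have := natDegree_derivative_le (P c)
  have := P_natDegree c
  omega

lemma G_inj (hd : 1 ≤ d) {s : ℝ} {v : Fin (d + 1) → ℝ} (hv : v ∈ V d s) {z : E d}
    (hz : Sol v z) : Function.Injective (fderiv ℝ G z) := by
  rw [injective_iff_map_eq_zero]
  intro u hu
  rw [G_line z u (by omega)] at hu
  have e1 := fun i => congrFun (congrArg Prod.fst hu) i
  have e2 := fun i => congrFun (congrArg Prod.snd hu) i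
  simp only [Prod.fst_zero, Prod.snd_zero, Pi.zero_apply] at e1 e2
  have u0 : u.2 0 = 0 := by simpa using e2 0
  have hl : Fin.last d ≠ 0 := by simp [Fin.ext_iff]; omega
  have ul : u.2 (Fin.last d) = 0 := by simpa [hl] using e2 (Fin.last d)
  have hP : P u.1 = 0 := by
    apply eq_zero_of_nodes hz.mono.injective (P_natDegree _)
    intro i
    have := e1 i
    by_cases h0 : i = 0
    · subst h0; simpa [u0] using this
    by_cases h1 : i = Fin.last d
    · subst h1; simpa [ul] using this
    · rw [hz.crit i (by simp [inner, h0, h1])] at this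
      simpa using this
  have hu1 : u.1 = 0 := by
    ext k; rw [← P_coeff u.1, hP]; simp
  have hu2 : u.2 = 0 := by
    ext i
    by_cases h0 : i = 0
    · subst h0; simpa using u0
    by_cases h1 : i = Fin.last d
    · subst h1; simpa using ul
    have := e2 i
    simp only [h0, h1, if_false, hP, derivative_zero, eval_zero, zero_add] at this
    rcases mul_eq_zero.1 this with h | h
    · exact absurd h (crit_simple hd hz.mono.injective (deriv_deg hd _) (deriv_ne_zero hd hv hz)
        hz.crit i (by simp [inner, h0, h1]))
    · simpa using h
  exact Prod.ext hu1 hu2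

/-- Local structure. -/
lemma local_str (hd : 1 ≤ d) {s : ℝ} {v : Fin (d + 1) → ℝ} (hv : v ∈ V d s) {z : E d}
    (hz : Sol v z) : map G (𝓝 z) = 𝓝 (G z) ∧ ∃ U ∈ 𝓝 z, InjOn G U := by
  have hs : HasStrictFDerivAt G (fderiv ℝ G z) z :=
    G_contDiff.contDiffAt.hasStrictFDerivAt (by norm_num)
  let e : E d ≃L[ℝ] E d := (LinearEquiv.ofInjectiveEndo (fderiv ℝ G z : E d →ₗ[ℝ] E d)
    (G_inj hd hv hz)).toContinuousLinearEquiv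
  have he : (e : E d →L[ℝ] E d) = fderiv ℝ G z := by
    refine ContinuousLinearMap.ext fun u => rfl
  rw [← he] at hs
  refine ⟨hs.map_nhds_eq_of_equiv, (hs.toOpenPartialHomeomorph G).source, ?_, ?_⟩
  · exact (hs.toOpenPartialHomeomorph G).open_source.mem_nhds hs.mem_toOpenPartialHomeomorph_source
  · exact (hs.toOpenPartialHomeomorph G).injOn


lemma exists_lap (hd : 1 ≤ d) {x : Fin (d + 1) → ℝ} (x0 : x 0 = 0)
    (x1 : x (Fin.last d) = 1) {t : ℝ} (ht : t ∈ Icc (0 : ℝ) 1) :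
    ∃ i : Fin d, t ∈ Icc (x i.castSucc) (x i.succ) := by
  have hne : (Finset.univ.filter (fun i : Fin d => x i.castSucc ≤ t)).Nonempty := by
    refine ⟨⟨0, hd⟩, ?_⟩
    simp only [Finset.mem_filter, Finset.mem_univ, true_and]
    have : (Fin.castSucc ⟨0, hd⟩ : Fin (d + 1)) = 0 := by ext; simp
    rw [this, x0]; exact ht.1
  obtain ⟨i, hi, hmax⟩ := Finset.exists_max_image _ (fun i : Fin d => i) hne
  simp only [Finset.mem_filter, Finset.mem_univ, true_and] at hi hmax
  refine ⟨i, hi, ?_⟩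
  by_cases hl : (i : ℕ) + 1 = d
  · have : i.succ = Fin.last d := by ext; simp [hl]
    rw [this, x1]; exact ht.2
  · by_contra hcon
    push Not at hcon
    have h2 : (i : ℕ) + 1 < d := by have := i.2; omega
    have e : (Fin.castSucc ⟨(i : ℕ) + 1, h2⟩ : Fin (d + 1)) = i.succ := by ext; simp
    have := hmax ⟨(i : ℕ) + 1, h2⟩ (by rw [e]; exact hcon.le)
    simp [Fin.le_def] at this

lemma sol_laps (hd : 1 ≤ d) {s : ℝ} {v : Fin (d + 1) → ℝ} (hv : v ∈ V d s) {z : E d}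
    (hz : Sol v z) (i : Fin d) : StrictMonoOn (fun t => s * (-1) ^ (i : ℕ) * (P z.1).eval t)
      (Icc (z.2 i.castSucc) (z.2 i.succ)) := by
  have hσ : s * (-1) ^ (i : ℕ) ≠ 0 := by
    intro h; have := hv i; rw [h] at this; simp at this
  set σ := s * (-1) ^ (i : ℕ) with hσd
  have hder : ∀ t, HasDerivAt (fun t => σ * (P z.1).eval t) (σ * (derivative (P z.1)).eval t) t :=
    fun t => ((P z.1).hasDerivAt t).const_mul σ
  have hlt : z.2 i.castSucc < z.2 i.succ := hz.mono i.castSucc_lt_succ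
  have hnz : ∀ t ∈ Ioo (z.2 i.castSucc) (z.2 i.succ), σ * (derivative (P z.1)).eval t ≠ 0 := by
    intro t ht
    apply mul_ne_zero hσ
    apply crit_ne hd hz.mono.injective (deriv_deg hd _) (deriv_ne_zero hd hv hz) hz.crit
    rintro j hj rfl
    have h1 := hz.mono.lt_iff_lt.1 ht.1
    have h2 := hz.mono.lt_iff_lt.1 ht.2
    simp only [Fin.lt_def, Fin.val_castSucc, Fin.val_succ] at h1 h2
    omega
  have hc : ContinuousOn (fun t => σ * (P z.1).eval t) (Icc (z.2 i.castSucc) (z.2 i.succ)) :=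
    fun t _ => (hder t).continuousAt.continuousWithinAt
  rcases hasDerivWithinAt_forall_lt_or_forall_gt_of_forall_ne (convex_Ioo _ _)
    (fun t _ => (hder t).hasDerivWithinAt) hnz with h | h
  · exfalso
    have hanti : StrictAntiOn (fun t => σ * (P z.1).eval t)
        (Icc (z.2 i.castSucc) (z.2 i.succ)) := by
      apply strictAntiOn_of_deriv_neg (convex_Icc _ _) hc
      intro t ht
      rw [interior_Icc] at ht
      rw [(hder t).deriv]
      exact h t ht
    have := hanti (left_mem_Icc.2 hlt.le) (right_mem_Icc.2 hlt.le) hlt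
    simp only [hz.val] at this
    have := hv i
    rw [mul_sub] at this
    linarith
  · apply strictMonoOn_of_deriv_pos (convex_Icc _ _) hc
    intro t ht
    rw [interior_Icc] at ht
    rw [(hder t).deriv]
    exact h t ht

lemma sol_bound (hd : 1 ≤ d) {s : ℝ} {v : Fin (d + 1) → ℝ} (hv : v ∈ V d s) {z : E d}
    (hz : Sol v z) {M : ℝ} (hM : ∀ i, |v i| ≤ M) {t : ℝ} (ht : t ∈ Icc (0 : ℝ) 1) :
    |(P z.1).eval t| ≤ M := by
  obtain ⟨i, hi⟩ := exists_lap hd hz.zero hz.last ht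
  have hm := (sol_laps hd hv hz i).monotoneOn
  have hlt : z.2 i.castSucc < z.2 i.succ := hz.mono i.castSucc_lt_succ
  have h1 := hm (left_mem_Icc.2 hlt.le) hi hi.1
  have h2 := hm hi (right_mem_Icc.2 hlt.le) hi.2
  have hσ : s * (-1) ^ (i : ℕ) ≠ 0 := by
    intro h; have := hv i; rw [h] at this; simp at this
  simp only [hz.val] at h1 h2
  have a1 := abs_le.1 (hM i.castSucc)
  have a2 := abs_le.1 (hM i.succ)
  rcases lt_or_gt_of_ne hσ with h | h
  · have b1 := (mul_le_mul_left_of_neg h).1 h1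
    have b2 := (mul_le_mul_left_of_neg h).1 h2
    rw [abs_le]; constructor <;> linarith
  · have b1 := (mul_le_mul_iff_right₀ h).1 h1
    have b2 := (mul_le_mul_iff_right₀ h).1 h2
    rw [abs_le]; constructor <;> linarith

lemma coeff_bound (hd : 1 ≤ d) : ∃ K : ℝ, 0 < K ∧ ∀ c : Fin (d + 1) → ℝ, ∀ M, 0 ≤ M →
    (∀ t ∈ Icc (0 : ℝ) 1, |(P c).eval t| ≤ M) → ‖c‖ ≤ K * M := by
  let y : Fin (d + 1) → ℝ := fun k => (k : ℕ) / (d : ℝ)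
  have hd' : (0 : ℝ) < d := by exact_mod_cast hd
  have hy : Function.Injective y := by
    intro a b hab
    simp only [y] at hab
    rw [div_left_inj' hd'.ne'] at hab
    exact Fin.ext (by exact_mod_cast hab)
  let T : (Fin (d + 1) → ℝ) →ₗ[ℝ] (Fin (d + 1) → ℝ) :=
    { toFun := fun c k => (P c).eval (y k)
      map_add' := by intro a b; ext k; simp [P_add]
      map_smul' := by intro a b; ext k; simp [P_smul] }
  have hT : LinearMap.ker T = ⊥ := by
    rw [LinearMap.ker_eq_bot']
    intro c hc
    have : P c = 0 := eq_zero_of_nodes hy (P_natDegree _) (fun i => congrFun hc i)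
    ext k; rw [← P_coeff c, this]; simp
  obtain ⟨K, hK, hA⟩ := T.exists_antilipschitzWith hT
  refine ⟨K, hK, fun c M hM h => ?_⟩
  have h1 := hA.le_mul_dist c 0
  simp only [map_zero, dist_zero_right] at h1
  refine h1.trans (mul_le_mul_of_nonneg_left ?_ K.2)
  rw [pi_norm_le_iff_of_nonneg hM]
  intro k
  apply h
  constructor
  · positivity
  · simp only [y]
    rw [div_le_one hd']
    exact_mod_cast Nat.lt_succ_iff.1 k.2

lemma deriv_bound {c : Fin (d + 1) → ℝ} {B : ℝ} (hB : ‖c‖ ≤ B) {t : ℝ}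
    (ht : t ∈ Icc (0 : ℝ) 1) : |(derivative (P c)).eval t| ≤ (d + 1) * (B * d) := by
  have hB0 : 0 ≤ B := (norm_nonneg _).trans hB
  rw [P_deriv_eval]
  refine (Finset.abs_sum_le_sum_abs _ _).trans ?_
  have : ∀ k ∈ (Finset.univ : Finset (Fin (d + 1))),
      |c k * ((k : ℕ) * t ^ ((k : ℕ) - 1))| ≤ B * d := by
    intro k _
    rw [abs_mul]
    apply mul_le_mul ((norm_le_pi_norm c k).trans hB) _ (abs_nonneg _) hB0
    have h1 : t ^ ((k : ℕ) - 1) ≤ 1 := pow_le_one₀ ht.1 ht.2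
    have h0 : 0 ≤ t ^ ((k : ℕ) - 1) := pow_nonneg ht.1 _
    rw [abs_of_nonneg (by positivity)]
    have h2 : ((k : ℕ) : ℝ) ≤ d := by exact_mod_cast Nat.lt_succ_iff.1 k.2
    have h3 : (0 : ℝ) ≤ (k : ℕ) := by positivity
    nlinarith
  refine (Finset.sum_le_card_nsmul _ _ _ this).trans ?_
  simp

lemma strictMono_iff {x : Fin (d + 1) → ℝ} :
    StrictMono x ↔ ∀ i : Fin d, x i.castSucc < x i.succ := Fin.strictMono_iff_lt_succ

lemma compact_sol (hd : 1 ≤ d) (s M m : ℝ) (hM : 0 ≤ M) (hm : 0 < m) :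
    ∃ K : Set (E d), IsCompact K ∧ (∀ z ∈ K, StrictMono z.2) ∧
      ∀ v ∈ V d s, (∀ i, |v i| ≤ M) → (∀ i : Fin d, m ≤ |v i.succ - v i.castSucc|) →
        ∀ z, Sol v z → z ∈ K := by
  obtain ⟨K₀, hK₀, hK⟩ := coeff_bound hd
  set B := K₀ * M with hB
  have hB0 : 0 ≤ B := by positivity
  set L := (d + 1) * (B * d) with hL
  have hL0 : 0 ≤ L := by positivity
  let S : Set (E d) := {z | ∀ i : Fin d, m ≤ L * (z.2 i.succ - z.2 i.castSucc)}
  refine ⟨(Metric.closedBall 0 B ×ˢ Icc 0 1) ∩ S, ?_, ?_, ?_⟩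
  · apply IsCompact.inter_right ((isCompact_closedBall _ _).prod isCompact_Icc)
    have : S = ⋂ i : Fin d, {z | m ≤ L * (z.2 i.succ - z.2 i.castSucc)} := by
      ext z; simp [S]
    rw [this]
    apply isClosed_iInter
    intro i
    exact isClosed_le continuous_const (by fun_prop)
  · rintro z ⟨_, hz⟩
    rw [strictMono_iff]
    intro i
    have := hz i
    by_contra hcon
    push Not at hcon
    nlinarith
  · intro v hv hvM hvm z hz
    have hc : ‖z.1‖ ≤ B := hK z.1 M hM (fun t ht => sol_bound hd hv hz hvM ht)
    have hI : ∀ i, z.2 i ∈ Icc (0 : ℝ) 1 := by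
      intro i
      rw [← hz.zero, ← hz.last]
      exact ⟨hz.mono.monotone (Fin.zero_le _), hz.mono.monotone (Fin.le_last _)⟩
    refine ⟨⟨by simpa using hc, fun i => (hI i).1, fun i => (hI i).2⟩, fun i => ?_⟩
    refine (hvm i).trans ?_
    rw [← hz.val, ← hz.val]
    have := Convex.norm_image_sub_le_of_norm_hasDerivWithin_le (f := fun t => (P z.1).eval t)
      (f' := fun t => (derivative (P z.1)).eval t) (C := L) (s := Icc (0 : ℝ) 1)
      (fun t _ => ((P z.1).hasDerivAt t).hasDerivWithinAt)
      (fun t ht => deriv_bound hc ht) (convex_Icc _ _) (hI i.castSucc) (hI i.succ)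
    rw [Real.norm_eq_abs, Real.norm_eq_abs,
      abs_of_nonneg (sub_nonneg.2 (hz.mono i.castSucc_lt_succ).le)] at this
    exact this

lemma seq_compact (hd : 1 ≤ d) {s : ℝ} {v : Fin (d + 1) → ℝ} (hv : v ∈ V d s)
    {vn : ℕ → Fin (d + 1) → ℝ} (hvn : ∀ n, vn n ∈ V d s) (hlim : Tendsto vn atTop (𝓝 v))
    {zn : ℕ → E d} (hzn : ∀ n, Sol (vn n) (zn n)) :
    ∃ z, Sol v z ∧ ∃ φ : ℕ → ℕ, StrictMono φ ∧ Tendsto (zn ∘ φ) atTop (𝓝 z) := by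
  obtain ⟨m, hm, hmv⟩ : ∃ m : ℝ, 0 < m ∧ ∀ i : Fin d, m < |v i.succ - v i.castSucc| := by
    obtain ⟨i, _, hi⟩ := Finset.exists_min_image Finset.univ
      (fun i : Fin d => |v i.succ - v i.castSucc|) ⟨⟨0, hd⟩, Finset.mem_univ _⟩
    have hp : 0 < |v i.succ - v i.castSucc| := abs_pos.2 (sub_ne_zero.2 (V_ne hv i))
    refine ⟨|v i.succ - v i.castSucc| / 2, by linarith, fun j => ?_⟩
    have := hi j (Finset.mem_univ _)
    linarith
  obtain ⟨K, hK, hKm, hKs⟩ := compact_sol hd s (‖v‖ + 1) m (by positivity) hm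
  have ev : ∀ᶠ n in atTop, zn n ∈ K := by
    have e1 : ∀ᶠ n in atTop, ‖vn n‖ < ‖v‖ + 1 :=
      hlim.norm.eventually (gt_mem_nhds (by linarith))
    have e2 : ∀ᶠ n in atTop, ∀ i : Fin d, m < |vn n i.succ - vn n i.castSucc| := by
      rw [eventually_all]
      intro i
      have : Tendsto (fun n => |vn n i.succ - vn n i.castSucc|) atTop
          (𝓝 |v i.succ - v i.castSucc|) :=
        (((tendsto_pi_nhds.1 hlim i.succ)).sub (tendsto_pi_nhds.1 hlim i.castSucc)).abs
      exact this.eventually (lt_mem_nhds (hmv i))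
    filter_upwards [e1, e2] with n h1 h2
    exact hKs _ (hvn n) (fun i => (norm_le_pi_norm (vn n) i).trans h1.le) (fun i => (h2 i).le) _
      (hzn n)
  obtain ⟨z, hz, φ, hφ, hφl⟩ := hK.tendsto_subseq' ev.frequently
  refine ⟨z, ?_, φ, hφ, hφl⟩
  rw [sol_iff hd]
  refine ⟨hKm z hz, ?_⟩
  have h1 : Tendsto (fun n => G (zn (φ n))) atTop (𝓝 (G z)) :=
    (G_contDiff.continuous.tendsto z).comp hφl
  have h2 : Tendsto (fun n => ((vn (φ n), 0) : E d)) atTop (𝓝 (v, 0)) :=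
    (hlim.comp hφ.tendsto_atTop).prodMk_nhds tendsto_const_nhds
  refine tendsto_nhds_unique h1 (h2.congr fun n => ?_)
  exact (((sol_iff hd _ _).1 (hzn (φ n))).2).symm

lemma isOpen_V (s : ℝ) : IsOpen (V d s) := by
  have : V d s = ⋂ i : Fin d, {v | 0 < s * (-1) ^ (i : ℕ) * (v i.succ - v i.castSucc)} := by
    ext z; simp [V]
  rw [this]
  apply isOpen_iInter_of_finite
  intro i
  exact isOpen_lt continuous_const (by fun_prop)

lemma convex_V (s : ℝ) : Convex ℝ (V d s) := by
  intro x hx y hy a b ha hb hab i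
  have h1 := hx i
  have h2 := hy i
  simp only [Pi.add_apply, Pi.smul_apply, smul_eq_mul]
  have : s * (-1) ^ (i : ℕ) * (a * x i.succ + b * y i.succ - (a * x i.castSucc + b * y i.castSucc))
    = a * (s * (-1) ^ (i : ℕ) * (x i.succ - x i.castSucc))
      + b * (s * (-1) ^ (i : ℕ) * (y i.succ - y i.castSucc)) := by ring
  rw [this]
  rcases ha.lt_or_eq with h | h
  · have := mul_pos h h1
    have := mul_nonneg hb h2.le
    linarith
  · subst h
    have : b = 1 := by linarith
    subst this
    linarith

lemma open_step (hd : 1 ≤ d) {s : ℝ} {v : Fin (d + 1) → ℝ} (hv : v ∈ V d s) {z : E d}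
    (hz : Sol v z) {U : Set (E d)} (hU : U ∈ 𝓝 z) : ∀ᶠ w in 𝓝 v, ∃ z' ∈ U, Sol w z' := by
  have ho : IsOpen {z : E d | StrictMono z.2} := by
    have : {z : E d | StrictMono z.2} = ⋂ i : Fin d, {z | z.2 i.castSucc < z.2 i.succ} := by
      ext z; simp [strictMono_iff]
    rw [this]
    apply isOpen_iInter_of_finite
    intro i
    exact isOpen_lt (by fun_prop) (by fun_prop)
  have h1 : U ∩ {z : E d | StrictMono z.2} ∈ 𝓝 z := inter_mem hU (ho.mem_nhds hz.mono)
  have h2 : G '' (U ∩ {z : E d | StrictMono z.2}) ∈ 𝓝 ((v, 0) : E d) := by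
    rw [← ((sol_iff hd _ _).1 hz).2, ← (local_str hd hv hz).1]
    exact image_mem_map h1
  have h3 : Tendsto (fun w : Fin (d + 1) → ℝ => ((w, 0) : E d)) (𝓝 v) (𝓝 (v, 0)) :=
    tendsto_id.prodMk_nhds tendsto_const_nhds
  filter_upwards [h3 h2] with w hw
  obtain ⟨z', ⟨h4, h5⟩, h6⟩ := hw
  exact ⟨z', h4, (sol_iff hd _ _).2 ⟨h5, h6⟩⟩

lemma exists_sol (hd : 1 ≤ d) {s : ℝ} (hne : ∃ v ∈ V d s, ∃ z, Sol v z)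
    {v : Fin (d + 1) → ℝ} (hv : v ∈ V d s) : ∃ z, Sol v z := by
  let u : Set (Fin (d + 1) → ℝ) := {v | v ∈ V d s ∧ ∃ z, Sol v z}
  have hsub : V d s ⊆ u := by
    apply (convex_V s).isPreconnected.subset_of_closure_inter_subset
    · rw [isOpen_iff_mem_nhds]
      rintro v ⟨hv, z, hz⟩
      filter_upwards [(isOpen_V s).mem_nhds hv, open_step hd hv hz univ_mem] with w hw hw'
      obtain ⟨z', _, hz'⟩ := hw'
      exact ⟨hw, z', hz'⟩
    · obtain ⟨v, hv, h⟩ := hne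
      exact ⟨v, hv, hv, h⟩
    · rintro v ⟨hc, hv⟩
      obtain ⟨vn, hvn, hlim⟩ := mem_closure_iff_seq_limit.1 hc
      choose zn hzn using fun n => (hvn n).2
      obtain ⟨z, hz, _⟩ := seq_compact hd hv (fun n => (hvn n).1) hlim hzn
      exact ⟨hv, z, hz⟩
  exact (hsub hv).2

lemma unique_sol (hd : 1 ≤ d) {s : ℝ} (hne : ∃ v ∈ V d s, ∀ z w, Sol v z → Sol v w → z = w)
    {v : Fin (d + 1) → ℝ} (hv : v ∈ V d s) {z w : E d} (hz : Sol v z) (hw : Sol v w) : z = w := by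
  by_contra hzw
  let u : Set (Fin (d + 1) → ℝ) := {v | v ∈ V d s ∧ ∃ z w, Sol v z ∧ Sol v w ∧ z ≠ w}
  have hsub : V d s ⊆ u := by
    apply (convex_V s).isPreconnected.subset_of_closure_inter_subset
    · rw [isOpen_iff_mem_nhds]
      rintro v ⟨hv, z, w, hz, hw, hzw⟩
      obtain ⟨A, B, hA, hB, hzA, hwB, hdis⟩ := t2_separation hzw
      filter_upwards [(isOpen_V s).mem_nhds hv, open_step hd hv hz (hA.mem_nhds hzA),
        open_step hd hv hw (hB.mem_nhds hwB)] with x hx h1 h2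
      obtain ⟨z', hz1, hz2⟩ := h1
      obtain ⟨w', hw1, hw2⟩ := h2
      exact ⟨hx, z', w', hz2, hw2, hdis.ne_of_mem hz1 hw1⟩
    · exact ⟨v, hv, hv, z, w, hz, hw, hzw⟩
    · rintro v ⟨hc, hv⟩
      obtain ⟨vn, hvn, hlim⟩ := mem_closure_iff_seq_limit.1 hc
      choose hV zn wn hzn hwn hne using hvn
      obtain ⟨z, hz, φ, hφ, hzl⟩ := seq_compact hd hv hV hlim hzn
      obtain ⟨w, hw, ψ, hψ, hwl⟩ := seq_compact hd hv (fun n => hV (φ n))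
        (hlim.comp hφ.tendsto_atTop) (fun n => hwn (φ n))
      refine ⟨hv, z, w, hz, hw, ?_⟩
      rintro rfl
      obtain ⟨U, hU, hinj⟩ := (local_str hd hv hz).2
      have e1 := (hzl.comp hψ.tendsto_atTop).eventually_mem hU
      have e2 := hwl.eventually_mem hU
      obtain ⟨n, hn1, hn2⟩ := (e1.and e2).exists
      apply hne (φ (ψ n))
      apply hinj hn1 hn2
      simp only [Function.comp]
      rw [((sol_iff hd _ _).1 (hzn _)).2, ((sol_iff hd _ _).1 (hwn _)).2]
  obtain ⟨v', hv', h⟩ := hne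
  obtain ⟨_, z', w', h1, h2, h3⟩ := hsub hv'
  exact h3 (h _ _ h1 h2)

lemma weight_sign {y : Fin (d + 1) → ℝ} (hy : StrictMono y) (i : Fin (d + 1)) :
    0 < (-1) ^ d * (-1) ^ (i : ℕ) * ∏ j ∈ Finset.univ.erase i, (y i - y j) := by
  have hu : (Finset.univ : Finset (Fin (d + 1))).erase i = Finset.Iio i ∪ Finset.Ioi i := by
    ext j
    simp only [Finset.mem_erase, Finset.mem_univ, and_true, Finset.mem_union, Finset.mem_Iio,
      Finset.mem_Ioi]
    exact ne_iff_lt_or_gt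
  have hdis : Disjoint (Finset.Iio i) (Finset.Ioi i) := by
    rw [Finset.disjoint_left]
    intro j h1 h2
    rw [Finset.mem_Iio] at h1
    rw [Finset.mem_Ioi] at h2
    exact lt_asymm h1 h2
  rw [hu, Finset.prod_union hdis]
  have h1 : 0 < ∏ j ∈ Finset.Iio i, (y i - y j) :=
    Finset.prod_pos fun j hj => sub_pos.2 (hy (Finset.mem_Iio.1 hj))
  have h2 : 0 < ∏ j ∈ Finset.Ioi i, ((-1) * (y i - y j)) :=
    Finset.prod_pos fun j hj => by
      have := hy (Finset.mem_Ioi.1 hj)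
      linarith
  rw [Finset.prod_mul_distrib, Finset.prod_const, Fin.card_Ioi] at h2
  have h3 : (-1 : ℝ) ^ d * (-1) ^ (i : ℕ) = (-1) ^ (d + 1 - 1 - (i : ℕ)) := by
    have hi : (i : ℕ) ≤ d := Nat.lt_succ_iff.1 i.2
    obtain ⟨k, hk⟩ := Nat.exists_eq_add_of_le hi
    have e : d + 1 - 1 - (i : ℕ) = k := by omega
    have hp : (-1 : ℝ) ^ d = (-1) ^ ((i : ℕ) + k) := congrArg _ hk
    rw [e, hp, pow_add]
    have : (-1 : ℝ) ^ (i : ℕ) * (-1) ^ (i : ℕ) = 1 := by rw [← mul_pow]; simp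
    linear_combination (-1 : ℝ) ^ k * this
  rw [h3]
  have := mul_pos h1 h2
  linarith

lemma cheb_cmp {r : ℝ[X]} (hr : r.natDegree ≤ d) {y : Fin (d + 1) → ℝ} (hy : StrictMono y)
    (σ : ℝ) (h : ∀ i : Fin (d + 1), 0 ≤ σ * (-1) ^ (i : ℕ) * r.eval (y i)) :
    0 ≤ σ * (-1) ^ d * r.coeff d ∧
      (r.coeff d = 0 → ∀ i : Fin (d + 1), σ * (-1) ^ (i : ℕ) * r.eval (y i) = 0) := by
  have hco := Lagrange.coeff_eq_sum (s := Finset.univ) (v := y) (hy.injective.injOn) (P := r) (by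
    rw [Finset.card_univ, Fintype.card_fin]
    exact lt_of_le_of_lt degree_le_natDegree (by exact_mod_cast Nat.lt_succ_iff.2 hr))
  rw [Finset.card_univ, Fintype.card_fin, Nat.add_sub_cancel] at hco
  have hsq : ∀ n : ℕ, (-1 : ℝ) ^ n * (-1) ^ n = 1 := fun n => by rw [← mul_pow]; simp
  have key : σ * (-1) ^ d * r.coeff d = ∑ i : Fin (d + 1), (σ * (-1) ^ (i : ℕ) * r.eval (y i)) /
      ((-1) ^ d * (-1) ^ (i : ℕ) * ∏ j ∈ Finset.univ.erase i, (y i - y j)) := by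
    rw [hco, Finset.mul_sum]
    apply Finset.sum_congr rfl
    intro i _
    have hw := (weight_sign hy i).ne'
    have hw' : ∏ j ∈ Finset.univ.erase i, (y i - y j) ≠ 0 := right_ne_zero_of_mul hw
    rw [mul_div_assoc', div_eq_div_iff hw' hw]
    linear_combination (σ * eval (y i) r * (∏ j ∈ Finset.univ.erase i, (y i - y j))
      * (-1) ^ (i : ℕ)) * hsq d
  have hnn : ∀ i ∈ (Finset.univ : Finset (Fin (d + 1))),
      0 ≤ (σ * (-1) ^ (i : ℕ) * r.eval (y i)) /
      ((-1) ^ d * (-1) ^ (i : ℕ) * ∏ j ∈ Finset.univ.erase i, (y i - y j)) :=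
    fun i _ => div_nonneg (h i) (weight_sign hy i).le
  refine ⟨key ▸ Finset.sum_nonneg hnn, fun h0 i => ?_⟩
  rw [h0, mul_zero] at key
  have := (Finset.sum_eq_zero_iff_of_nonneg hnn).1 key.symm i (Finset.mem_univ _)
  rcases div_eq_zero_iff.1 this with h1 | h1
  · exact h1
  · exact absurd h1 (weight_sign hy i).ne'

lemma nodes_subset (hd : 1 ≤ d) {s : ℝ} {v : Fin (d + 1) → ℝ} (hv : v ∈ V d s) {z w : E d}
    (hz : Sol v z) (hw : Sol v w) (h : z.1 = w.1) : range z.2 ⊆ range w.2 := by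
  rintro _ ⟨i, rfl⟩
  by_cases h0 : i = 0
  · exact ⟨0, by rw [h0, hz.zero, hw.zero]⟩
  by_cases h1 : i = Fin.last d
  · exact ⟨Fin.last d, by rw [h1, hz.last, hw.last]⟩
  by_contra hcon
  refine crit_ne hd hw.mono.injective (deriv_deg hd _) (deriv_ne_zero hd hv hw) hw.crit (z.2 i)
    ?_ ?_
  · intro j _ hj
    exact hcon ⟨j, hj.symm⟩
  · rw [← h]; exact hz.crit i (by simp [inner, h0, h1])

lemma sol_ext (hd : 1 ≤ d) {s : ℝ} {v : Fin (d + 1) → ℝ} (hv : v ∈ V d s) {z w : E d}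
    (hz : Sol v z) (hw : Sol v w) (h : z.1 = w.1) : z = w := by
  refine Prod.ext h ?_
  rw [← hz.mono.range_inj hw.mono]
  exact (nodes_subset hd hv hz hw h).antisymm (nodes_subset hd hv hw hz h.symm)

/-- Chebyshev values -/
def vC (d : ℕ) (s : ℝ) : Fin (d + 1) → ℝ := fun i => -s * (-1) ^ (i : ℕ)

lemma vC_mem {s : ℝ} (hs : s * s = 1) : vC d s ∈ V d s := by
  intro i
  simp only [vC, Fin.val_succ, Fin.val_castSucc, pow_succ]
  have : (-1 : ℝ) ^ (i : ℕ) * (-1) ^ (i : ℕ) = 1 := by rw [← mul_pow]; simp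
  have e : s * (-1) ^ (i : ℕ) * (-s * ((-1) ^ (i : ℕ) * -1) - -s * (-1) ^ (i : ℕ)) = 2 := by
    linear_combination (2 * ((-1 : ℝ) ^ (i : ℕ) * (-1) ^ (i : ℕ))) * hs + 2 * this
  rw [e]; norm_num

lemma vC_cmp (hd : 1 ≤ d) {s : ℝ} (hs : s * s = 1) {z w : E d} (hz : Sol (vC d s) z)
    (hw : Sol (vC d s) w) (i : Fin (d + 1)) :
    0 ≤ s * (-1) ^ (i : ℕ) * (P z.1 - P w.1).eval (w.2 i) := by
  have hsq : (-1 : ℝ) ^ (i : ℕ) * (-1) ^ (i : ℕ) = 1 := by rw [← mul_pow]; simp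
  have hs1 : |s| = 1 := by
    have := abs_mul_abs_self s
    rw [hs] at this
    nlinarith [abs_nonneg s]
  have hb : |(P z.1).eval (w.2 i)| ≤ 1 := by
    apply sol_bound hd (vC_mem hs) hz
    · intro j; simp [vC, abs_mul, hs1]
    · rw [← hw.zero, ← hw.last]
      exact ⟨hw.mono.monotone (Fin.zero_le _), hw.mono.monotone (Fin.le_last _)⟩
  have hb2 : |s * (-1) ^ (i : ℕ) * (P z.1).eval (w.2 i)| ≤ 1 := by
    simpa [abs_mul, hs1] using hb
  rw [eval_sub, hw.val, vC]
  have e : s * (-1) ^ (i : ℕ) * (eval (w.2 i) (P z.1) - -s * (-1) ^ (i : ℕ))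
    = s * (-1) ^ (i : ℕ) * eval (w.2 i) (P z.1) + 1 := by
    linear_combination ((-1 : ℝ) ^ (i : ℕ) * (-1) ^ (i : ℕ)) * hs + hsq
  rw [e]
  have := (abs_le.1 hb2).1
  linarith

lemma vC_unique (hd : 1 ≤ d) {s : ℝ} (hs : s * s = 1) (z w : E d) (hz : Sol (vC d s) z)
    (hw : Sol (vC d s) w) : z = w := by
  have hs0 : s ≠ 0 := by rintro rfl; simp at hs
  apply sol_ext hd (vC_mem hs) hz hw
  have dg : ∀ z w : E d, (P z.1 - P w.1).natDegree ≤ d := fun z w =>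
    (natDegree_sub_le _ _).trans (max_le (P_natDegree _) (P_natDegree _))
  have h1 := cheb_cmp (dg z w) hw.mono s (vC_cmp hd hs hz hw)
  have h2 := cheb_cmp (dg w z) hz.mono s (vC_cmp hd hs hw hz)
  have h3 : s * (-1) ^ d * (P z.1 - P w.1).coeff d = 0 := by
    apply le_antisymm _ h1.1
    have := h2.1
    rw [coeff_sub] at this ⊢
    linarith
  have h4 : (P z.1 - P w.1).coeff d = 0 := by
    rcases mul_eq_zero.1 h3 with h | h
    · exact absurd h (mul_ne_zero hs0 (pow_ne_zero _ (by norm_num)))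
    · exact h
  have h5 := h1.2 h4
  have h6 : P z.1 - P w.1 = 0 := by
    apply eq_zero_of_nodes hw.mono.injective (dg z w)
    intro i
    rcases mul_eq_zero.1 (h5 i) with h | h
    · exact absurd h (mul_ne_zero hs0 (pow_ne_zero _ (by norm_num)))
    · exact h
  exact P_inj (sub_eq_zero.1 h6)

lemma vC_exists (hd : 1 ≤ d) (s : ℝ) : ∃ z : E d, Sol (vC d s) z := by
  let p : ℝ[X] := C (-s) * (Chebyshev.T ℝ (d : ℤ)).comp (1 - 2 * X)
  have hdeg : p.natDegree ≤ d := by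
    refine (natDegree_C_mul_le _ _).trans ?_
    refine natDegree_comp_le.trans ?_
    rw [Chebyshev.natDegree_T]
    have : (1 - 2 * X : ℝ[X]).natDegree ≤ 1 := by compute_degree
    simpa using Nat.mul_le_mul_left d this
  have hev : ∀ t, p.eval t = -s * (Chebyshev.T ℝ (d : ℤ)).eval (1 - 2 * t) := by
    intro t; simp [p]
  have hder : ∀ t, (derivative p).eval t =
      -s * ((derivative (Chebyshev.T ℝ (d : ℤ))).eval (1 - 2 * t) * (-2)) := by
    intro t; simp [p, derivative_comp]; left; ring
  have hn : ∀ i : Fin (d + 1), 1 - 2 * ((1 - Chebyshev.node d i) / 2) = Chebyshev.node d i :=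
    fun i => by ring
  refine ⟨(fun k => p.coeff k, fun i => (1 - Chebyshev.node d i) / 2), ?_, ?_, ?_, ?_, ?_⟩
  · intro i j hij
    have := Chebyshev.node_lt (n := d) (Nat.lt_succ_iff.1 j.2) hij
    simp only
    linarith
  · simp [Chebyshev.node_eq_one]
  · simp [Chebyshev.node_eq_neg_one (show d ≠ 0 by omega)]
  · intro i
    simp only
    rw [P_of p hdeg, hev, hn, Chebyshev.eval_T_real_node (by simpa using Nat.lt_succ_iff.1 i.2)]
    rfl
  · intro i hi
    simp only
    rw [P_of p hdeg, hder, hn]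
    simp only [inner, Finset.mem_filter, Finset.mem_univ, true_and, ne_eq, Fin.ext_iff,
      Fin.val_zero, Fin.val_last] at hi
    have := (Chebyshev.isLocalExtr_T_real (n := d) (k := i) (by omega) (by omega)
      (by omega)).deriv_eq_zero
    rw [Polynomial.deriv] at this
    rw [Chebyshev.node, this]
    simp

theorem existsUnique_sol (hd : 1 ≤ d) {s : ℝ} (hs : s * s = 1) {v : Fin (d + 1) → ℝ}
    (hv : v ∈ V d s) : ∃! z, Sol v z := by
  obtain ⟨z, hz⟩ := exists_sol hd ⟨vC d s, vC_mem hs, vC_exists hd s⟩ hv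
  exact ⟨z, hz, fun w hw => unique_sol hd ⟨vC d s, vC_mem hs, vC_unique hd hs⟩ hv hw hz⟩

/-- a map with given laps -/
structure Laps (e : Fin d → ℝ) (f : ℝ → ℝ) (x v : Fin (d + 1) → ℝ) : Prop where
  mono : StrictMono x
  zero : x 0 = 0
  last : x (Fin.last d) = 1
  cont : ContinuousOn f (Icc (0 : ℝ) 1)
  lap : ∀ i : Fin d, StrictMonoOn (fun t => e i * f t) (Icc (x i.castSucc) (x i.succ))
  val : ∀ i, f (x i) = v i

lemma Laps.mem {e : Fin d → ℝ} {f : ℝ → ℝ} {x v : Fin (d + 1) → ℝ} (h : Laps e f x v)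
    (i : Fin (d + 1)) : x i ∈ Icc (0 : ℝ) 1 := by
  rw [← h.zero, ← h.last]
  exact ⟨h.mono.monotone (Fin.zero_le _), h.mono.monotone (Fin.le_last _)⟩

lemma Laps.e_ne {e : Fin d → ℝ} {f : ℝ → ℝ} {x v : Fin (d + 1) → ℝ} (h : Laps e f x v)
    (i : Fin d) : e i ≠ 0 := by
  intro h0
  have hlt : x i.castSucc < x i.succ := h.mono i.castSucc_lt_succ
  have := h.lap i (left_mem_Icc.2 hlt.le) (right_mem_Icc.2 hlt.le) hlt
  simp [h0] at this

/-- matching relation between points -/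
def R (f : ℝ → ℝ) (a : Fin (d + 1) → ℝ) (g : ℝ → ℝ) (x : Fin (d + 1) → ℝ) (t u : ℝ) : Prop :=
  ∃ i : Fin d, t ∈ Icc (x i.castSucc) (x i.succ) ∧ u ∈ Icc (a i.castSucc) (a i.succ) ∧ g t = f u

lemma R_symm {f : ℝ → ℝ} {a : Fin (d + 1) → ℝ} {g : ℝ → ℝ} {x : Fin (d + 1) → ℝ} {t u : ℝ}
    (h : R f a g x t u) : R g x f a u t := by
  obtain ⟨i, h1, h2, h3⟩ := h
  exact ⟨i, h2, h1, h3.symm⟩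

lemma R_exists (hd : 1 ≤ d) {e : Fin d → ℝ} {f g : ℝ → ℝ} {a x v : Fin (d + 1) → ℝ}
    (hf : Laps e f a v) (hg : Laps e g x v) {t : ℝ} (ht : t ∈ Icc (0 : ℝ) 1) :
    ∃ u ∈ Icc (0 : ℝ) 1, R f a g x t u := by
  obtain ⟨i, hi⟩ := exists_lap hd hg.zero hg.last ht
  have hltx : x i.castSucc < x i.succ := hg.mono i.castSucc_lt_succ
  have hlta : a i.castSucc < a i.succ := hf.mono i.castSucc_lt_succ
  have h1 := (hg.lap i).monotoneOn (left_mem_Icc.2 hltx.le) hi hi.1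
  have h2 := (hg.lap i).monotoneOn hi (right_mem_Icc.2 hltx.le) hi.2
  simp only [hg.val] at h1 h2
  have hsub : Icc (a i.castSucc) (a i.succ) ⊆ Icc (0 : ℝ) 1 :=
    Icc_subset_Icc (hf.mem _).1 (hf.mem _).2
  have hc : ContinuousOn (fun t => e i * f t) (Icc (a i.castSucc) (a i.succ)) :=
    continuousOn_const.mul (hf.cont.mono hsub)
  have hiv := intermediate_value_Icc hlta.le hc
  simp only [hf.val] at hiv
  obtain ⟨u, hu, hu'⟩ := hiv ⟨h1, h2⟩
  exact ⟨u, hsub hu, i, hi, hu, (mul_left_cancel₀ (hf.e_ne i) hu').symm⟩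

lemma Laps.injOn {e : Fin d → ℝ} {f : ℝ → ℝ} {x v : Fin (d + 1) → ℝ} (h : Laps e f x v)
    (i : Fin d) : InjOn f (Icc (x i.castSucc) (x i.succ)) := by
  intro t ht u hu htu
  apply (h.lap i).injOn ht hu
  simp [htu]

lemma R_lt {e : Fin d → ℝ} {f g : ℝ → ℝ} {a x v : Fin (d + 1) → ℝ}
    (hf : Laps e f a v) (hg : Laps e g x v) {t u t' u' : ℝ} (h : R f a g x t u)
    (h' : R f a g x t' u') (htt : t < t') : u < u' := by
  obtain ⟨i, h1, h2, h3⟩ := h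
  obtain ⟨j, h1', h2', h3'⟩ := h'
  rcases lt_trichotomy i j with hij | hij | hij
  · have hle : i.succ ≤ j.castSucc := by
      simp only [Fin.le_def, Fin.val_succ, Fin.val_castSucc]; exact hij
    have ha := hf.mono.monotone hle
    have hx := hg.mono.monotone hle
    by_contra hcon
    push Not at hcon
    have e1 : u = a i.succ := le_antisymm h2.2 (by linarith [h2'.1])
    have e2 : u' = a j.castSucc := le_antisymm (by linarith [h2.2]) h2'.1
    have e3 : a i.succ = a j.castSucc := le_antisymm ha (by linarith)
    have e4 : t = x i.succ := by
      apply hg.injOn i h1 (right_mem_Icc.2 (h1.1.trans h1.2))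
      rw [h3, e1, hf.val, hg.val]
    have e5 : t' = x j.castSucc := by
      apply hg.injOn j h1' (left_mem_Icc.2 (h1'.1.trans h1'.2))
      rw [h3', e2, hf.val, hg.val]
    rw [e4, e5, hf.mono.injective e3] at htt
    exact lt_irrefl _ htt
  · subst hij
    have := hg.lap i h1 h1' htt
    simp only [h3, h3'] at this
    exact ((hf.lap i).lt_iff_lt h2 h2').1 this
  · have hle : j.succ ≤ i.castSucc := by
      simp only [Fin.le_def, Fin.val_succ, Fin.val_castSucc]; exact hij
    have hx := hg.mono.monotone hle
    linarith [h1.1, h1'.2]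

lemma R_unique {e : Fin d → ℝ} {f g : ℝ → ℝ} {a x v : Fin (d + 1) → ℝ}
    (hf : Laps e f a v) (hg : Laps e g x v) {t u u' : ℝ} (h : R f a g x t u)
    (h' : R f a g x t u') : u = u' := by
  rcases lt_trichotomy u u' with hlt | he | hlt
  · exact absurd (R_lt hg hf (R_symm h) (R_symm h') hlt) (lt_irrefl _)
  · exact he
  · exact absurd (R_lt hg hf (R_symm h') (R_symm h) hlt) (lt_irrefl _)

lemma exists_h (hd : 1 ≤ d) {e : Fin d → ℝ} {f g : ℝ → ℝ} {a x v : Fin (d + 1) → ℝ}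
    (hf : Laps e f a v) (hg : Laps e g x v) :
    ∃ h : Icc (0 : ℝ) 1 → Icc (0 : ℝ) 1, StrictMono h ∧ Function.Surjective h ∧
      ∀ t, f (h t) = g t := by
  choose u hu hR using fun t : Icc (0 : ℝ) 1 => R_exists hd hf hg t.2
  refine ⟨fun t => ⟨u t, hu t⟩, ?_, ?_, ?_⟩
  · intro t t' htt
    exact R_lt hf hg (hR t) (hR t') htt
  · intro y
    obtain ⟨t, ht, hRt⟩ := R_exists hd hg hf y.2
    exact ⟨⟨t, ht⟩, Subtype.ext (R_unique hf hg (hR ⟨t, ht⟩) (R_symm hRt))⟩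
  · intro t
    obtain ⟨i, _, _, h3⟩ := hR t
    exact h3.symm

lemma sol_Laps (hd : 1 ≤ d) {s : ℝ} {v : Fin (d + 1) → ℝ} (hv : v ∈ V d s) {z : E d}
    (hz : Sol v z) : Laps (fun i : Fin d => s * (-1) ^ (i : ℕ)) (fun t => (P z.1).eval t) z.2 v :=
  ⟨hz.mono, hz.zero, hz.last, (P z.1).continuous.continuousOn, sol_laps hd hv hz, hz.val⟩

lemma sol_natDegree (hd : 1 ≤ d) {s : ℝ} {v : Fin (d + 1) → ℝ} (hv : v ∈ V d s) {z : E d}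
    (hz : Sol v z) : (P z.1).natDegree = d := by
  apply le_antisymm (P_natDegree _)
  by_contra hcon
  push Not at hcon
  apply deriv_ne_zero hd hv hz
  apply eq_zero_of_natDegree_lt_card_of_eval_eq_zero' _ ((inner d).image z.2)
  · intro y hy
    rw [Finset.mem_image] at hy
    obtain ⟨i, hi, rfl⟩ := hy
    exact hz.crit i hi
  · rw [Finset.card_image_of_injective _ hz.mono.injective]
    have h1 := inner_card hd
    have h2 := natDegree_derivative_le (P z.1)
    by_cases h0 : (P z.1).natDegree = 0
    · exact absurd (derivative_eq_zero.2 h0) (deriv_ne_zero hd hv hz)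
    · omega

lemma sol_of_h {s : ℝ} {f : ℝ → ℝ} {a v : Fin (d + 1) → ℝ}
    (hf : Laps (fun i : Fin d => s * (-1) ^ (i : ℕ)) f a v)
    (h : Icc (0 : ℝ) 1 ≃o Icc (0 : ℝ) 1) (p : ℝ[X]) (hp : p.natDegree = d)
    (hfp : ∀ x : Icc (0 : ℝ) 1, f (h x) = p.eval (x : ℝ)) :
    Sol v (fun k => p.coeff k, fun i => ((h.symm ⟨a i, hf.mem i⟩ : Icc (0 : ℝ) 1) : ℝ)) := by
  have hmono : StrictMono
      (fun i => ((h.symm ⟨a i, hf.mem i⟩ : Icc (0 : ℝ) 1) : ℝ)) := by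
    intro i j hij
    have : (⟨a i, hf.mem i⟩ : Icc (0 : ℝ) 1) < ⟨a j, hf.mem j⟩ := hf.mono hij
    exact h.symm.strictMono this
  refine ⟨hmono, ?_, ?_, ?_, ?_⟩
  · have : (⟨a 0, hf.mem 0⟩ : Icc (0 : ℝ) 1) = ⊥ := Subtype.ext hf.zero
    simp only
    rw [this, OrderIso.map_bot]; rfl
  · have : (⟨a (Fin.last d), hf.mem _⟩ : Icc (0 : ℝ) 1) = ⊤ := Subtype.ext hf.last
    simp only
    rw [this, OrderIso.map_top]; rfl
  · intro i
    simp only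
    rw [P_of p hp.le, ← hfp, h.apply_symm_apply, hf.val]
  · intro i hi
    simp only
    rw [P_of p hp.le]
    simp only [inner, Finset.mem_filter, Finset.mem_univ, true_and, ne_eq, Fin.ext_iff,
      Fin.val_zero, Fin.val_last] at hi
    have hi2 := i.2
    obtain ⟨j, hj⟩ : ∃ j : Fin d, (j : ℕ) + 1 = i := ⟨⟨(i : ℕ) - 1, by omega⟩, by simp; omega⟩
    obtain ⟨k, hk⟩ : ∃ k : Fin d, (k : ℕ) = i := ⟨⟨(i : ℕ), by omega⟩, rfl⟩
    have hjs : j.succ = i := by ext; simp [hj]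
    have hks : k.castSucc = i := by ext; simp [hk]
    have hjl := hf.lap j
    have hkl := hf.lap k
    rw [hjs] at hjl
    rw [hks] at hkl
    set σ := s * (-1) ^ (j : ℕ) with hσ
    have hσ0 : σ ≠ 0 := hf.e_ne j
    have hkσ : s * (-1) ^ (k : ℕ) = -σ := by
      rw [hk, ← hj, pow_succ]; ring
    simp only [hkσ] at hkl
    have hmax : ∀ u ∈ Icc (a j.castSucc) (a k.succ), σ * f u ≤ σ * f (a i) := by
      intro u hu
      rcases le_total u (a i) with hui | hui
      · exact hjl.monotoneOn ⟨hu.1, hui⟩ (right_mem_Icc.2 (hu.1.trans hui)) hui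
      · have := hkl.monotoneOn (left_mem_Icc.2 (hui.trans hu.2)) ⟨hui, hu.2⟩ hui
        linarith
    set y : Fin (d + 1) → ℝ := fun i => ((h.symm ⟨a i, hf.mem i⟩ : Icc (0 : ℝ) 1) : ℝ) with hy
    have hloc : IsLocalMax (fun t => σ * p.eval t) (y i) := by
      have hn : Icc (y j.castSucc) (y k.succ) ∈ 𝓝 (y i) := by
        apply Icc_mem_nhds
        · apply hmono; rw [← hjs]; exact j.castSucc_lt_succ
        · apply hmono; rw [← hks]; exact k.castSucc_lt_succ
      filter_upwards [hn] with t ht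
      have ht01 : t ∈ Icc (0 : ℝ) 1 :=
        ⟨(h.symm ⟨a j.castSucc, hf.mem _⟩).2.1.trans ht.1,
          ht.2.trans (h.symm ⟨a k.succ, hf.mem _⟩).2.2⟩
      have e1 := hfp ⟨t, ht01⟩
      have e2 := hfp (h.symm ⟨a i, hf.mem i⟩)
      rw [h.apply_symm_apply] at e2
      simp only [hy]
      rw [← e2, ← e1]
      apply hmax
      constructor
      · have h1 : h.symm ⟨a j.castSucc, hf.mem _⟩ ≤ ⟨t, ht01⟩ := ht.1
        exact (h.symm_apply_le).1 h1
      · have h1 : ⟨t, ht01⟩ ≤ h.symm ⟨a k.succ, hf.mem _⟩ := ht.2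
        exact (h.le_symm_apply).1 h1
    have hd0 := hloc.hasDerivAt_eq_zero ((p.hasDerivAt (y i)).const_mul σ)
    exact (mul_eq_zero.1 hd0).resolve_left hσ0

lemma R_of_h (hd : 1 ≤ d) {s : ℝ} {f : ℝ → ℝ} {a v : Fin (d + 1) → ℝ}
    (hf : Laps (fun i : Fin d => s * (-1) ^ (i : ℕ)) f a v) {z : E d} (hz : Sol v z)
    (h : Icc (0 : ℝ) 1 ≃o Icc (0 : ℝ) 1) (p : ℝ[X]) (hp : p.natDegree = d)
    (hfp : ∀ x : Icc (0 : ℝ) 1, f (h x) = p.eval (x : ℝ))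
    (hzz : ((fun k => p.coeff k, fun i => ((h.symm ⟨a i, hf.mem i⟩ : Icc (0 : ℝ) 1) : ℝ)) : E d)
      = z) (t : Icc (0 : ℝ) 1) : R f a (fun t => (P z.1).eval t) z.2 t (h t) := by
  obtain ⟨i, hi⟩ := exists_lap hd hz.zero hz.last t.2
  refine ⟨i, hi, ?_, ?_⟩
  · subst hzz
    constructor
    · have h1 : h.symm ⟨a i.castSucc, hf.mem _⟩ ≤ t := hi.1
      exact (h.symm_apply_le).1 h1
    · have h1 : t ≤ h.symm ⟨a i.succ, hf.mem _⟩ := hi.2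
      exact (h.le_symm_apply).1 h1
  · rw [hfp, ← hzz]
    simp only
    rw [P_of p hp.le]

end ThurstonStep


/-- The first step of Thurston's algorithm for interval maps: given a continuous
piecewise-monotone map `f₀` of `[0,1]` with `d` alternately ascending and
descending laps, carrying boundary points to boundary points, there is a unique
orientation-preserving homeomorphism `h₀` of `[0,1]` such that `f₀ ∘ h₀` is the
restriction of a polynomial of degree `d`. -/
theorem thurston_step_interval
    (d : ℕ) (hd : 1 ≤ d)
    (f₀ : ℝ → ℝ)
    (hcont : ContinuousOn f₀ (Icc (0 : ℝ) 1))
    (hmaps : MapsTo f₀ (Icc (0 : ℝ) 1) (Icc (0 : ℝ) 1))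
    (hbd : f₀ '' ({0, 1} : Set ℝ) ⊆ ({0, 1} : Set ℝ))
    (a : Fin (d + 1) → ℝ) (ha : StrictMono a)
    (ha0 : a 0 = 0) (had : a (Fin.last d) = 1)
    (dir : Fin d → Bool)
    (hmono : ∀ i : Fin d, dir i = true →
      StrictMonoOn f₀ (Icc (a i.castSucc) (a i.succ)))
    (hanti : ∀ i : Fin d, dir i = false →
      StrictAntiOn f₀ (Icc (a i.castSucc) (a i.succ)))
    (halt : ∀ i j : Fin d, (j : ℕ) = (i : ℕ) + 1 → dir j = !(dir i)) :
    ∃! h₀ : (Icc (0 : ℝ) 1) → (Icc (0 : ℝ) 1),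
      Continuous h₀ ∧ StrictMono h₀ ∧ Function.Bijective h₀ ∧
      h₀ ⟨0, by norm_num⟩ = ⟨0, by norm_num⟩ ∧
      h₀ ⟨1, by norm_num⟩ = ⟨1, by norm_num⟩ ∧
      ∃ p : Polynomial ℝ, p.natDegree = d ∧
        ∀ x : (Icc (0 : ℝ) 1), f₀ ((h₀ x : ℝ)) = p.eval (x : ℝ) := by
  classical
  let s : ℝ := if dir ⟨0, hd⟩ = true then 1 else -1
  have hs : s * s = 1 := by simp only [s]; split_ifs <;> norm_num
  have hdir : ∀ n (h : n < d), s * (-1) ^ n = if dir ⟨n, h⟩ = true then 1 else -1 := by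
    intro n
    induction n with
    | zero => intro h; simp [s]
    | succ n ih =>
      intro h
      have h1 := ih (by omega)
      have h2 := halt ⟨n, by omega⟩ ⟨n + 1, h⟩ rfl
      rw [h2, pow_succ, ← mul_assoc, h1]
      cases dir ⟨n, by omega⟩ <;> simp
  have hf : ThurstonStep.Laps (fun i : Fin d => s * (-1) ^ (i : ℕ)) f₀ a (fun i => f₀ (a i)) := by
    refine ⟨ha, ha0, had, hcont, ?_, fun i => rfl⟩
    intro i
    have hi := hdir i i.2
    simp only [hi]
    cases hdi : dir i with
    | true =>
      have := hmono i hdi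
      simpa using this
    | false =>
      have := hanti i hdi
      intro x hx y hy hxy
      have := this hx hy hxy
      simpa using this
  have hv : (fun i => f₀ (a i)) ∈ ThurstonStep.V d s := by
    intro i
    have hlt : a i.castSucc < a i.succ := ha i.castSucc_lt_succ
    have := hf.lap i (left_mem_Icc.2 hlt.le) (right_mem_Icc.2 hlt.le) hlt
    simp only at this
    rw [mul_sub]
    linarith
  obtain ⟨z, hz, huniq⟩ := ThurstonStep.existsUnique_sol hd hs hv
  have hg := ThurstonStep.sol_Laps hd hv hz
  obtain ⟨h, hm, hsurj, hval⟩ := ThurstonStep.exists_h hd hf hg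
  refine ⟨h, ⟨hm.monotone.continuous_of_surjective hsurj, hm, ⟨hm.injective, hsurj⟩, ?_, ?_,
    ThurstonStep.P z.1, ThurstonStep.sol_natDegree hd hv hz, hval⟩, ?_⟩
  · exact map_bot (StrictMono.orderIsoOfSurjective h hm hsurj)
  · exact map_top (StrictMono.orderIsoOfSurjective h hm hsurj)
  · rintro k ⟨_, kmono, kbij, _, _, q, hq, hkq⟩
    let H := StrictMono.orderIsoOfSurjective h hm hsurj
    let K := StrictMono.orderIsoOfSurjective k kmono kbij.2
    have zH := huniq _ (ThurstonStep.sol_of_h hf H _ (ThurstonStep.sol_natDegree hd hv hz) hval)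
    have zK := huniq _ (ThurstonStep.sol_of_h hf K q hq hkq)
    funext t
    apply Subtype.ext
    exact ThurstonStep.R_unique hf hg
      (ThurstonStep.R_of_h hd hf hz K q hq hkq zK t)
      (ThurstonStep.R_of_h hd hf hz H _ (ThurstonStep.sol_natDegree hd hv hz) hval zH t)
end

section
/- Let λ and μ be real numbers with 1/e < λ < μ. Then the exponential maps E_λ(z) = λe^z and E_μ(z) = μe^z are not topologically conjugate: there is no homeomorphism h : ℂ → ℂ such that h(λ·exp(z)) = μ·exp(h(z)) for all z ∈ ℂ. -/
open Filter Topology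

/-- The orbit of `0` under `x ↦ l e^x`. -/
noncomputable def orb (l : ℝ) : ℕ → ℝ
  | 0 => 0
  | n + 1 => l * Real.exp (orb l n)

theorem int_valued_const {α : Type*} [TopologicalSpace α] {S : Set α} (hS : IsPreconnected S)
    {g : α → ℝ} (hg : ContinuousOn g S) (hi : ∀ x ∈ S, ∃ n : ℤ, g x = n)
    {x y : α} (hx : x ∈ S) (hy : y ∈ S) : g x = g y := by
  have key : ∀ x ∈ S, ∀ y ∈ S, ¬ g x < g y := by
    intro x hx y hy hlt
    obtain ⟨p, hp⟩ := hi x hx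
    obtain ⟨q, hq⟩ := hi y hy
    have hpq : p + 1 ≤ q := by
      rw [hp, hq] at hlt
      have : p < q := by exact_mod_cast hlt
      omega
    have hpq' : (p : ℝ) + 1 ≤ q := by exact_mod_cast hpq
    obtain ⟨z, hz, hz'⟩ := hS.intermediate_value hx hy hg
      (show (p : ℝ) + 1 / 2 ∈ Set.Icc (g x) (g y) by
        rw [hp, hq]; constructor <;> linarith)
    obtain ⟨r, hr⟩ := hi z hz
    rw [hr] at hz'
    have h2 : (2 * r : ℝ) = 2 * p + 1 := by linarith
    have h3 : 2 * r = 2 * p + 1 := by exact_mod_cast h2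
    omega
  exact le_antisymm (not_lt.1 (key y hy x hx)) (not_lt.1 (key x hx y hy))

theorem one_add_log_pos {l : ℝ} (hl : 1 / Real.exp 1 < l) : 0 < l ∧ 0 < 1 + Real.log l := by
  have h0 : 0 < 1 / Real.exp 1 := by positivity
  have hl0 : 0 < l := h0.trans hl
  refine ⟨hl0, ?_⟩
  have := Real.log_lt_log h0 hl
  rw [one_div, Real.log_inv, Real.log_exp] at this
  linarith

theorem E_ge {l : ℝ} (hl0 : 0 < l) (x : ℝ) : x + (1 + Real.log l) ≤ l * Real.exp x := by
  have h1 := Real.add_one_le_exp (x + Real.log l)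
  rw [Real.exp_add, Real.exp_log hl0] at h1
  linarith

theorem orb_ge {l : ℝ} (hl0 : 0 < l) (n : ℕ) : n * (1 + Real.log l) ≤ orb l n := by
  induction n with
  | zero => simp [orb]
  | succ n ih =>
    have := E_ge hl0 (orb l n)
    rw [orb]; push_cast; linarith

theorem orb_tendsto {l : ℝ} (hl : 1 / Real.exp 1 < l) : Tendsto (orb l) atTop atTop := by
  obtain ⟨hl0, h1⟩ := one_add_log_pos hl
  exact tendsto_atTop_mono (orb_ge hl0) (tendsto_natCast_atTop_atTop.atTop_mul_const h1)

theorem orb_nonneg {l : ℝ} (hl0 : 0 < l) (n : ℕ) : 0 ≤ orb l n := by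
  cases n with
  | zero => simp [orb]
  | succ n => rw [orb]; positivity

theorem orb_lt {l m : ℝ} (hl0 : 0 < l) (hlm : l < m) (n : ℕ) : orb l (n + 1) < orb m (n + 1) := by
  induction n with
  | zero => simpa [orb] using hlm
  | succ n ih =>
    rw [orb, orb.eq_2 m]
    have := Real.exp_lt_exp.2 ih
    exact mul_lt_mul hlm this.le (Real.exp_pos _) (hl0.trans hlm).le

section conj
variable {l m : ℝ} {h : ℂ ≃ₜ ℂ}

theorem conj_zero (hl0 : 0 < l) (hm0 : 0 < m)
    (hc : ∀ z : ℂ, h ((l : ℂ) * Complex.exp z) = (m : ℂ) * Complex.exp (h z)) : h 0 = 0 := by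
  by_contra hne
  have hm : (m : ℂ) ≠ 0 := by exact_mod_cast hm0.ne'
  have h1 := hc (h.symm (Complex.log (h 0 / m)))
  rw [h.apply_symm_apply, Complex.exp_log (div_ne_zero hne hm), mul_div_cancel₀ _ hm] at h1
  have h2 := h.injective h1
  have : (l : ℂ) ≠ 0 := by exact_mod_cast hl0.ne'
  exact mul_ne_zero this (Complex.exp_ne_zero _) h2

theorem conj_orb (hl0 : 0 < l) (hm0 : 0 < m)
    (hc : ∀ z : ℂ, h ((l : ℂ) * Complex.exp z) = (m : ℂ) * Complex.exp (h z)) (n : ℕ) :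
    h (orb l n : ℂ) = (orb m n : ℂ) := by
  induction n with
  | zero => simpa [orb] using conj_zero hl0 hm0 hc
  | succ n ih =>
    rw [orb, orb.eq_2 m]
    push_cast
    rw [hc, ih]

theorem conj_real (hc : ∀ z : ℂ, h ((l : ℂ) * Complex.exp z) = (m : ℂ) * Complex.exp (h z))
    (t : ℝ) : h ((l * Real.exp t : ℝ) : ℂ) = (m : ℂ) * Complex.exp (h t) := by
  push_cast; exact hc _

theorem conj_re (hc : ∀ z : ℂ, h ((l : ℂ) * Complex.exp z) = (m : ℂ) * Complex.exp (h z))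
    (t : ℝ) : (h ((l * Real.exp t : ℝ) : ℂ)).re
      = m * Real.exp (h t).re * Real.cos (h t).im := by
  rw [conj_real hc, Complex.re_ofReal_mul, Complex.exp_re, mul_assoc]

theorem conj_im (hc : ∀ z : ℂ, h ((l : ℂ) * Complex.exp z) = (m : ℂ) * Complex.exp (h z))
    (t : ℝ) : (h ((l * Real.exp t : ℝ) : ℂ)).im
      = m * Real.exp (h t).re * Real.sin (h t).im := by
  rw [conj_real hc, Complex.im_ofReal_mul, Complex.exp_im, mul_assoc]

theorem conj_re_tendsto (hl0 : 0 < l) (hm0 : 0 < m)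
    (hc : ∀ z : ℂ, h ((l : ℂ) * Complex.exp z) = (m : ℂ) * Complex.exp (h z)) :
    Tendsto (fun t : ℝ => (h (t : ℂ)).re) atTop atTop := by
  have h1 : Tendsto (fun t : ℝ => ((l * Real.exp t : ℝ) : ℂ)) atTop (cocompact ℂ) := by
    rw [← Metric.cobounded_eq_cocompact, ← comap_norm_atTop, tendsto_comap_iff]
    have : Tendsto (fun t : ℝ => l * Real.exp t) atTop atTop :=
      Real.tendsto_exp_atTop.const_mul_atTop hl0
    refine this.congr fun t => ?_
    simp only [Function.comp, Complex.norm_real, Real.norm_eq_abs]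
    rw [abs_of_pos (by positivity)]
  have h2 : Tendsto (fun t : ℝ => ‖h ((l * Real.exp t : ℝ) : ℂ)‖) atTop atTop :=
    (tendsto_norm_cocompact_atTop (E := ℂ)).comp
      ((h.isClosedEmbedding.tendsto_cocompact).comp h1)
  have h3 : Tendsto (fun t : ℝ => Real.log (‖h ((l * Real.exp t : ℝ) : ℂ)‖) + (- Real.log m))
      atTop atTop := tendsto_atTop_add_const_right _ _ (Real.tendsto_log_atTop.comp h2)
  refine h3.congr fun t => ?_
  rw [conj_real hc, norm_mul, Complex.norm_exp, Complex.norm_real, Real.norm_eq_abs,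
    abs_of_pos hm0, Real.log_mul hm0.ne' (Real.exp_pos _).ne', Real.log_exp]
  ring

/-- Pull-back step for reality. -/
theorem conj_pull (hm0 : 0 < m)
    (hc : ∀ z : ℂ, h ((l : ℂ) * Complex.exp z) = (m : ℂ) * Complex.exp (h z))
    {S : Set ℝ} (hS : IsPreconnected S) {p : ℝ} (hp : p ∈ S) (hp0 : (h (p : ℂ)).im = 0)
    (hE : ∀ t ∈ S, (h ((l * Real.exp t : ℝ) : ℂ)).im = 0) {t : ℝ} (ht : t ∈ S) :
    (h (t : ℂ)).im = 0 := by
  have hcont : Continuous fun t : ℝ => (h (t : ℂ)).im / Real.pi := by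
    have := h.continuous
    fun_prop
  have := int_valued_const hS hcont.continuousOn (x := t) (y := p) ?_ ht hp
  · simp only [hp0, zero_div] at this
    have hpi := Real.pi_ne_zero
    field_simp at this
    simpa using this
  · intro x hx
    have h1 := hE x hx
    rw [conj_im hc] at h1
    have h2 : Real.sin (h x).im = 0 := by
      rcases mul_eq_zero.1 h1 with h3 | h3
      · exact absurd h3 (by positivity)
      · exact h3
    obtain ⟨n, hn⟩ := Real.sin_eq_zero_iff.1 h2
    refine ⟨n, ?_⟩
    rw [← hn]
    field_simp

theorem conj_tail (hl : 1 / Real.exp 1 < l) (hm0 : 0 < m)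
    (hc : ∀ z : ℂ, h ((l : ℂ) * Complex.exp z) = (m : ℂ) * Complex.exp (h z)) :
    ∃ T : ℝ, ∀ t ≥ T, (h (t : ℂ)).im = 0 := by
  obtain ⟨hl0, hl1⟩ := one_add_log_pos hl
  have hre := conj_re_tendsto hl0 hm0 hc
  have e1 : ∀ᶠ t : ℝ in atTop, 0 < (h (t : ℂ)).re := hre.eventually_gt_atTop 0
  have e2 : ∀ᶠ t : ℝ in atTop, Real.pi ≤ m * Real.exp (h (t : ℂ)).re :=
    ((Real.tendsto_exp_atTop.comp hre).const_mul_atTop hm0).eventually_ge_atTop _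
  obtain ⟨T, hT⟩ := eventually_atTop.1 (e1.and e2)
  have hE : ∀ t, t ≤ l * Real.exp t := fun t => by have := E_ge hl0 t; linarith
  have hcos : ∀ t ≥ T, 0 < Real.cos (h (t : ℂ)).im := by
    intro t ht
    have h1 := (hT _ (ht.le.trans (hE t))).1
    rw [conj_re hc] at h1
    exact pos_of_mul_pos_right h1 (by positivity)
  have hcont : Continuous fun t : ℝ => (h (t : ℂ)).im := by
    have := h.continuous
    fun_prop
  obtain ⟨n, hn⟩ := ((orb_tendsto hl).eventually_ge_atTop T).exists
  have hn0 : (h (orb l n : ℂ)).im = 0 := by rw [conj_orb hl0 hm0 hc]; simp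
  have hpi := Real.pi_pos
  have hb : ∀ t ≥ T, |(h (t : ℂ)).im| ≤ Real.pi / 2 := by
    intro t ht
    by_contra hlt
    rw [not_le, lt_abs] at hlt
    rcases hlt with hlt | hlt
    · obtain ⟨s, hs, hs'⟩ := (isPreconnected_Ici (a := T)).intermediate_value hn ht
        hcont.continuousOn (show Real.pi / 2 ∈ Set.Icc _ _ by
          simp only [hn0]; constructor <;> linarith)
      have := hcos s hs
      simp only at hs'
      rw [hs', Real.cos_pi_div_two] at this
      exact lt_irrefl _ this
    · obtain ⟨s, hs, hs'⟩ := (isPreconnected_Ici (a := T)).intermediate_value ht hn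
        hcont.continuousOn (show -(Real.pi / 2) ∈ Set.Icc _ _ by
          simp only [hn0]; constructor <;> linarith)
      have := hcos s hs
      simp only at hs'
      rw [hs', Real.cos_neg, Real.cos_pi_div_two] at this
      exact lt_irrefl _ this
  have hexp : ∀ t ≥ T, 2 * |(h (t : ℂ)).im| ≤ |(h ((l * Real.exp t : ℝ) : ℂ)).im| := by
    intro t ht
    rw [conj_im hc, abs_mul, abs_of_pos (by positivity : 0 < m * Real.exp (h (t : ℂ)).re)]
    have h1 := Real.mul_abs_le_abs_sin (hb t ht)
    calc 2 * |(h (t : ℂ)).im| = Real.pi * (2 / Real.pi * |(h (t : ℂ)).im|) := by field_simp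
      _ ≤ _ := mul_le_mul (hT t ht).2 h1 (by positivity) (by positivity)
  have hit : ∀ k : ℕ, ∀ t ≥ T, 2 ^ k * |(h (t : ℂ)).im| ≤ Real.pi / 2 := by
    intro k
    induction k with
    | zero => intro t ht; simpa using hb t ht
    | succ k ih =>
      intro t ht
      have h1 := ih _ (ht.le.trans (hE t))
      have h2 := mul_le_mul_of_nonneg_left (hexp t ht) (by positivity : (0 : ℝ) ≤ 2 ^ k)
      rw [pow_succ]; linarith
  refine ⟨T, fun t ht => ?_⟩
  by_contra hne
  have hpos : 0 < |(h (t : ℂ)).im| := abs_pos.2 hne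
  obtain ⟨k, hk⟩ := pow_unbounded_of_one_lt (Real.pi / 2 / |(h (t : ℂ)).im|) (one_lt_two (α := ℝ))
  rw [div_lt_iff₀ hpos] at hk
  exact absurd (hit k t ht) (not_le.2 hk)

theorem conj_im_zero (hl : 1 / Real.exp 1 < l) (hm0 : 0 < m)
    (hc : ∀ z : ℂ, h ((l : ℂ) * Complex.exp z) = (m : ℂ) * Complex.exp (h z)) (t : ℝ) :
    (h (t : ℂ)).im = 0 := by
  obtain ⟨hl0, hl1⟩ := one_add_log_pos hl
  obtain ⟨T, hT⟩ := conj_tail hl hm0 hc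
  obtain ⟨n, hn⟩ := ((orb_tendsto hl).eventually_ge_atTop T).exists
  have horb : ∀ n, (h (orb l n : ℂ)).im = 0 := fun n => by rw [conj_orb hl0 hm0 hc]; simp
  have key : ∀ n, (∀ t ≥ orb l n, (h (t : ℂ)).im = 0) → ∀ t ≥ (0 : ℝ), (h (t : ℂ)).im = 0 := by
    intro n
    induction n with
    | zero => intro H; simpa [orb] using H
    | succ n ih =>
      intro H
      apply ih
      intro t ht
      refine conj_pull hm0 hc (isPreconnected_Ici (a := orb l n)) (Set.self_mem_Ici) (horb n) ?_ ht
      intro s hs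
      apply H
      rw [orb]
      exact mul_le_mul_of_nonneg_left (Real.exp_le_exp.2 hs) hl0.le
  have h0 := key n fun t ht => hT t (hn.trans ht)
  refine conj_pull hm0 hc isPreconnected_univ (Set.mem_univ (0 : ℝ)) (h0 0 le_rfl) ?_
    (Set.mem_univ t)
  intro s _
  exact h0 _ (by positivity)

theorem conj_pos (hl : 1 / Real.exp 1 < l) (hm0 : 0 < m)
    (hc : ∀ z : ℂ, h ((l : ℂ) * Complex.exp z) = (m : ℂ) * Complex.exp (h z)) {t : ℝ}
    (ht : 0 < t) : 0 < (h (t : ℂ)).re := by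
  obtain ⟨hl0, hl1⟩ := one_add_log_pos hl
  have h1 := conj_re hc (Real.log (t / l))
  rw [Real.exp_log (by positivity), mul_div_cancel₀ _ hl0.ne', conj_im_zero hl hm0 hc,
    Real.cos_zero] at h1
  rw [h1]; positivity

theorem conj_symm (hc : ∀ z : ℂ, h ((l : ℂ) * Complex.exp z) = (m : ℂ) * Complex.exp (h z))
    (z : ℂ) : h.symm ((m : ℂ) * Complex.exp z) = (l : ℂ) * Complex.exp (h.symm z) := by
  rw [Homeomorph.symm_apply_eq, hc, h.apply_symm_apply]

theorem conj_slit (hl : 1 / Real.exp 1 < l) (hm : 1 / Real.exp 1 < m)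
    (hc : ∀ z : ℂ, h ((l : ℂ) * Complex.exp z) = (m : ℂ) * Complex.exp (h z)) {w : ℂ}
    (hw : w ∈ Complex.slitPlane) : h w ∈ Complex.slitPlane := by
  have hl0 := (one_add_log_pos hl).1
  have hm0 := (one_add_log_pos hm).1
  by_contra hn
  rw [Complex.mem_slitPlane_iff, not_or, not_lt, not_not] at hn
  obtain ⟨h1, h2⟩ := hn
  have e1 : h w = ((h w).re : ℂ) := Complex.ext (by simp) (by simp [h2])
  have e2 : h.symm ((h w).re : ℂ) = w := by rw [← e1, h.symm_apply_apply]
  have e3 := conj_im_zero hm hl0 (conj_symm hc) (h w).re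
  rw [e2] at e3
  have e4 : w = (w.re : ℂ) := Complex.ext (by simp) (by simp [e3])
  have e5 : 0 < w.re := by
    rw [Complex.mem_slitPlane_iff] at hw
    rcases hw with hw | hw
    · exact hw
    · exact absurd e3 hw
  have e6 := conj_pos hl hm0 hc e5
  rw [← e4] at e6
  linarith

theorem two_pi_int {f : ℂ → ℂ} {S : Set ℂ} (hS : IsPreconnected S) (hf : ContinuousOn f S)
    (hi : ∀ z ∈ S, ∃ n : ℤ, f z = n * (2 * Real.pi * Complex.I)) {x y : ℂ} (hx : x ∈ S)
    (hy : y ∈ S) : f x = f y := by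
  have hpi := Real.pi_ne_zero
  have := int_valued_const hS (g := fun z => (f z).im / (2 * Real.pi))
    ((Complex.continuous_im.comp_continuousOn hf).div_const _) ?_ hx hy
  · obtain ⟨p, hp⟩ := hi x hx
    obtain ⟨q, hq⟩ := hi y hy
    simp only [hp, hq] at this
    have h3 : p = q := by simpa [hpi] using this
    rw [hp, hq, h3]
  · intro z hz
    obtain ⟨n, hn⟩ := hi z hz
    refine ⟨n, ?_⟩
    simp only [hn]
    simp

theorem conj_log (hl : 1 / Real.exp 1 < l) (hm : 1 / Real.exp 1 < m)
    (hc : ∀ z : ℂ, h ((l : ℂ) * Complex.exp z) = (m : ℂ) * Complex.exp (h z)) {w : ℂ}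
    (hw : w ∈ Complex.slitPlane) : h (Complex.log (w / l)) = Complex.log (h w / m) := by
  have hl0 := (one_add_log_pos hl).1
  have hm0 := (one_add_log_pos hm).1
  have hlc : (l : ℂ) ≠ 0 := by exact_mod_cast hl0.ne'
  have hmc : (m : ℂ) ≠ 0 := by exact_mod_cast hm0.ne'
  have hdiv : ∀ (a : ℝ), 0 < a → ∀ z ∈ Complex.slitPlane, z / (a : ℂ) ∈ Complex.slitPlane := by
    intro a ha z hz
    rw [Complex.mem_slitPlane_iff] at hz ⊢
    rw [Complex.div_ofReal_re, Complex.div_ofReal_im]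
    rcases hz with hz | hz
    · left; positivity
    · right; exact div_ne_zero hz ha.ne'
  have hS : IsPreconnected Complex.slitPlane :=
    (Complex.starConvex_one_slitPlane.isPathConnected Complex.one_mem_slitPlane).isConnected.isPreconnected
  have hcont : ContinuousOn (fun w => h (Complex.log (w / l)) - Complex.log (h w / m))
      Complex.slitPlane := by
    apply ContinuousOn.sub
    · apply h.continuous.comp_continuousOn
      apply ContinuousOn.clog
      · fun_prop
      · exact hdiv l hl0
    · apply ContinuousOn.clog
      · exact (h.continuous.div_const _).continuousOn
      · intro z hz
        exact hdiv m hm0 _ (conj_slit hl hm hc hz)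
  have hl_mem : (l : ℂ) ∈ Complex.slitPlane := by
    rw [Complex.mem_slitPlane_iff]; left; simpa using hl0
  have := two_pi_int hS hcont ?_ hw hl_mem
  · have e : h (l : ℂ) = m := by
      have := hc 0
      rwa [conj_zero hl0 hm0 hc, Complex.exp_zero, mul_one, mul_one] at this
    simp only [e, div_self hlc, div_self hmc, Complex.log_one, conj_zero hl0 hm0 hc, sub_zero] at this
    exact sub_eq_zero.1 this
  · intro z hz
    have h1 := hc (Complex.log (z / l))
    rw [Complex.exp_log (Complex.slitPlane_ne_zero (hdiv l hl0 z hz)), mul_div_cancel₀ _ hlc] at h1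
    have h2 : Complex.exp (h (Complex.log (z / l))) = Complex.exp (Complex.log (h z / m)) := by
      rw [Complex.exp_log (Complex.slitPlane_ne_zero (hdiv m hm0 _ (conj_slit hl hm hc hz))), h1,
        mul_div_cancel_left₀ _ hmc]
    obtain ⟨n, hn⟩ := Complex.exp_eq_exp_iff_exists_int.1 h2
    exact ⟨n, by rw [hn]; ring⟩

theorem conj_period (hm0 : 0 < m)
    (hc : ∀ z : ℂ, h ((l : ℂ) * Complex.exp z) = (m : ℂ) * Complex.exp (h z)) :
    ∃ d : ℤ, ∀ (k : ℕ) (z : ℂ), h (z + k * (2 * Real.pi * Complex.I))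
      = h z + k * (d * (2 * Real.pi * Complex.I)) := by
  have hmc : (m : ℂ) ≠ 0 := by exact_mod_cast hm0.ne'
  have hi : ∀ z : ℂ, ∃ n : ℤ, h (z + 2 * Real.pi * Complex.I) - h z
      = n * (2 * Real.pi * Complex.I) := by
    intro z
    have h1 := hc (z + 2 * Real.pi * Complex.I)
    rw [Complex.exp_periodic z, hc] at h1
    obtain ⟨n, hn⟩ := Complex.exp_eq_exp_iff_exists_int.1 (mul_left_cancel₀ hmc h1).symm
    exact ⟨n, by rw [hn]; ring⟩
  obtain ⟨d, hd⟩ := hi 0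
  refine ⟨d, fun k => ?_⟩
  have hstep : ∀ z : ℂ, h (z + 2 * Real.pi * Complex.I) = h z + d * (2 * Real.pi * Complex.I) := by
    intro z
    have hcont : Continuous fun z : ℂ => h (z + 2 * Real.pi * Complex.I) - h z := by
      have := h.continuous
      fun_prop
    have := two_pi_int isPreconnected_univ hcont.continuousOn (fun z _ => hi z)
      (Set.mem_univ z) (Set.mem_univ 0)
    simp only [hd] at this
    rw [← this]; ring
  induction k with
  | zero => intro z; simp
  | succ k ih =>
    intro z
    have : z + ((k + 1 : ℕ) : ℂ) * (2 * Real.pi * Complex.I)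
        = (z + k * (2 * Real.pi * Complex.I)) + 2 * Real.pi * Complex.I := by push_cast; ring
    rw [this, hstep, ih]; push_cast; ring

theorem log_im_pos {w : ℂ} (hw : 0 < w.im) (hl0 : 0 < l) : 0 < (Complex.log (w / l)).im := by
  rw [Complex.log_im]
  have h1 : 0 < (w / l).im := by rw [Complex.div_ofReal_im]; positivity
  refine lt_of_le_of_ne (Complex.arg_nonneg_iff.2 h1.le) fun h2 => ?_
  exact h1.ne' (Complex.arg_eq_zero_iff.1 h2.symm).2

theorem log_norm_ge (hl0 : 0 < l) (hlm : l < m) {w : ℂ} {i : ℕ} (hw : orb m (i + 1) ≤ ‖w‖) :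
    orb m i ≤ ‖Complex.log (w / l)‖ := by
  have hm0 := hl0.trans hlm
  refine le_trans ?_ ((le_abs_self _).trans (Complex.abs_re_le_norm _))
  rw [Complex.log_re, norm_div, Complex.norm_real, Real.norm_eq_abs, abs_of_pos hl0]
  rw [orb] at hw
  rw [Real.le_log_iff_exp_le (by
    have : 0 < ‖w‖ := lt_of_lt_of_le (by positivity) hw
    positivity), le_div_iff₀ hl0]
  refine le_trans ?_ hw
  rw [mul_comm]
  exact mul_le_mul_of_nonneg_right hlm.le (Real.exp_pos _).le

theorem log_split (hm0 : 0 < m) (i : ℕ) {u : ℂ} (hu : u ≠ 0) :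
    Complex.log (u / m) - orb m i = Complex.log (u / orb m (i + 1)) := by
  have hmc : (m : ℂ) ≠ 0 := by exact_mod_cast hm0.ne'
  have e : u / (m : ℂ) = ((Real.exp (orb m i) : ℝ) : ℂ) * (u / orb m (i + 1)) := by
    rw [orb]; push_cast
    have := Complex.exp_ne_zero (orb m i : ℂ)
    field_simp
  have hne : (orb m (i + 1) : ℂ) ≠ 0 := by
    rw [orb]; exact_mod_cast (by positivity : m * Real.exp (orb m i) ≠ 0)
  rw [e, Complex.log_ofReal_mul (Real.exp_pos _) (div_ne_zero hu hne), Real.log_exp]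
  ring

end conj

/-- For `1/e < λ < μ`, the exponential maps `E_λ(z) = λ e^z` and `E_μ(z) = μ e^z`
are not topologically conjugate. -/
theorem exp_maps_not_topologically_conjugate
    (l m : ℝ) (hl : 1 / Real.exp 1 < l) (hlm : l < m) :
    ¬ ∃ h : ℂ ≃ₜ ℂ, ∀ z : ℂ,
        h ((l : ℂ) * Complex.exp z) = (m : ℂ) * Complex.exp (h z) := by
  rintro ⟨h, hc⟩
  have hm := hl.trans hlm
  have hl0 := (one_add_log_pos hl).1
  have hm0 := (one_add_log_pos hm).1
  have hpi := Real.pi_pos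
  obtain ⟨d, hd⟩ := conj_period hm0 hc
  set C : ℝ := 2 * (|(d : ℝ)| * (2 * Real.pi)) with hC
  have hC0 : 0 ≤ C := by positivity
  set D : ℝ := Real.log (1 + C) + Real.pi with hD
  have hD0 : 0 < D := by
    have := Real.log_nonneg (by linarith : 1 ≤ 1 + C)
    linarith
  have hslit : ∀ w : ℂ, 0 < w.im → w ∈ Complex.slitPlane := fun w hw => by
    rw [Complex.mem_slitPlane_iff]; exact Or.inr hw.ne'
  obtain ⟨N, hN⟩ := eventually_atTop.1 ((orb_tendsto hm).eventually_ge_atTop (max (2 * D) 3))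
  -- contraction step
  have step : ∀ i ≥ N, ∀ (w : ℂ) (δ : ℝ), δ ≤ D → 0 < w.im → orb m (i + 1) ≤ ‖w‖ →
      ‖h w - orb m (i + 1)‖ ≤ δ → 0 < (Complex.log (w / l)).im ∧
      orb m i ≤ ‖Complex.log (w / l)‖ ∧ ‖h (Complex.log (w / l)) - orb m i‖ ≤ δ / 2 := by
    intro i hi w δ hδ hw hwn hh
    refine ⟨log_im_pos hw hl0, log_norm_ge hl0 hlm hwn, ?_⟩
    have hs := hslit w hw
    rw [conj_log hl hm hc hs, log_split hm0 i (Complex.slitPlane_ne_zero (conj_slit hl hm hc hs))]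
    have ha := hN (i + 1) (by omega)
    have ha1 := (le_max_left _ _).trans ha
    have ha2 := (le_max_right _ _).trans ha
    have ha0 : 0 < orb m (i + 1) := by linarith
    have hac : (orb m (i + 1) : ℂ) ≠ 0 := by exact_mod_cast ha0.ne'
    have e : h w / orb m (i + 1) = 1 + (h w - orb m (i + 1)) / orb m (i + 1) := by
      field_simp; ring
    have hnorm : ‖(h w - orb m (i + 1)) / (orb m (i + 1) : ℂ)‖
        = ‖h w - orb m (i + 1)‖ / orb m (i + 1) := by
      rw [norm_div, Complex.norm_real, Real.norm_eq_abs, abs_of_pos ha0]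
    rw [e]
    refine (Complex.norm_log_one_add_half_le_self ?_).trans ?_
    · rw [hnorm, div_le_iff₀ ha0]; linarith
    · rw [hnorm]
      have : ‖h w - orb m (i + 1)‖ / orb m (i + 1) ≤ δ / 3 :=
        div_le_div₀ ((norm_nonneg _).trans hh) hh (by norm_num) ha2
      linarith
  have iter : ∀ (j : ℕ) (w : ℂ) (δ : ℝ), δ ≤ D → 0 ≤ δ → 0 < w.im → orb m (N + j) ≤ ‖w‖ →
      ‖h w - orb m (N + j)‖ ≤ δ → ∃ v : ℂ, orb m N ≤ ‖v‖ ∧ ‖h v - orb m N‖ ≤ δ / 2 ^ j := by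
    intro j
    induction j with
    | zero => intro w δ _ _ _ h1 h2; exact ⟨w, h1, by simpa using h2⟩
    | succ j ih =>
      intro w δ hδ hδ0 hw h1 h2
      obtain ⟨p, q, r⟩ := step (N + j) (by omega) w δ hδ hw h1 h2
      obtain ⟨v, hv, hv'⟩ := ih _ (δ / 2) (by linarith) (by linarith) p q r
      exact ⟨v, hv, by rw [pow_succ', ← div_div]; exact hv'⟩
  have pts : ∀ j : ℕ, ∃ v : ℂ, orb m N ≤ ‖v‖ ∧ ‖h v - orb m N‖ ≤ D / 2 ^ j := by
    intro j
    set n := N + j with hn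
    have ha := hN (n + 1) (by omega)
    have ha3 := (le_max_right _ _).trans ha
    set a := orb m (n + 1) with ha_def
    have ha0 : 0 < a := by linarith
    have hac : (a : ℂ) ≠ 0 := by exact_mod_cast ha0.ne'
    set k := ⌈a⌉₊ with hk
    have hk1 : a ≤ k := Nat.le_ceil a
    have hk2 : (k : ℝ) ≤ 2 * a := by
      have := Nat.ceil_lt_add_one ha0.le
      linarith
    set w : ℂ := (orb l (n + 1) : ℂ) + k * (2 * Real.pi * Complex.I) with hw
    have him : w.im = k * (2 * Real.pi) := by simp [hw]
    have hwim : a ≤ w.im := by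
      rw [him]
      have := Real.pi_gt_three
      nlinarith
    have hwpos : 0 < w.im := by linarith
    have hs := hslit w hwpos
    have hhw : h w = a + k * (d * (2 * Real.pi * Complex.I)) := by
      rw [hw, hd, conj_orb hl0 hm0 hc]
    have hwn : a ≤ ‖w‖ := hwim.trans ((le_abs_self _).trans (Complex.abs_im_le_norm _))
    refine iter j (Complex.log (w / l)) D le_rfl hD0.le (log_im_pos hwpos hl0)
      (log_norm_ge hl0 hlm hwn) ?_
    rw [conj_log hl hm hc hs, log_split hm0 n (Complex.slitPlane_ne_zero (conj_slit hl hm hc hs)),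
      ← ha_def, hhw]
    set s : ℝ := k * (d * (2 * Real.pi)) / a with hsdef
    have e : ((a : ℂ) + k * (d * (2 * Real.pi * Complex.I))) / a = 1 + s * Complex.I := by
      rw [hsdef]; push_cast; field_simp
    have hsC : |s| ≤ C := by
      rw [hsdef, abs_div, abs_mul, abs_mul, abs_of_pos ha0, Nat.abs_cast,
        abs_of_pos (by positivity : 0 < 2 * Real.pi), div_le_iff₀ ha0, hC]
      have : 0 ≤ |(d : ℝ)| * (2 * Real.pi) := by positivity
      nlinarith
    rw [e]
    have n1 : 1 ≤ ‖(1 + s * Complex.I : ℂ)‖ := by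
      refine le_trans ?_ ((le_abs_self _).trans (Complex.abs_re_le_norm _))
      simp
    have n2 : ‖(1 + s * Complex.I : ℂ)‖ ≤ 1 + C := by
      refine (norm_add_le _ _).trans ?_
      simpa using hsC
    refine (Complex.norm_le_abs_re_add_abs_im _).trans ?_
    rw [Complex.log_re, Complex.log_im, abs_of_nonneg (Real.log_nonneg n1)]
    exact add_le_add (Real.log_le_log (by linarith) n2) (Complex.abs_arg_le_pi _)
  choose v hv1 hv2 using pts
  have hlim : Tendsto (fun j => h (v j)) atTop (𝓝 (orb m N : ℂ)) := by
    rw [tendsto_iff_norm_sub_tendsto_zero]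
    refine squeeze_zero (fun _ => norm_nonneg _) hv2 ?_
    exact tendsto_const_nhds.div_atTop (tendsto_pow_atTop_atTop_of_one_lt one_lt_two)
  have hlim2 : Tendsto v atTop (𝓝 (orb l N : ℂ)) := by
    have := (h.symm.continuous.tendsto _).comp hlim
    rw [← conj_orb hl0 hm0 hc, h.symm_apply_apply] at this
    refine this.congr fun j => ?_
    simp
  have hfin := ge_of_tendsto' hlim2.norm hv1
  rw [Complex.norm_real, Real.norm_eq_abs, abs_of_nonneg (orb_nonneg hl0 N)] at hfin
  rcases N with _ | N
  · have := (le_max_right _ _).trans (hN 0 le_rfl)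
    simp only [orb] at this
    linarith
  · exact absurd (orb_lt hl0 hlm N) (not_lt.2 hfin)
end

section
/- Let U ⊆ ℂ be open, let f be holomorphic on U, let z₀ ∈ U with f(z₀) = z₀, and suppose the multiplier λ = f'(z₀) satisfies λ = e^{2πiα} with α irrational. Then there is no nonempty open connected set D ⊆ U with f(D) ⊆ D such that the iterates f^n converge uniformly on D to the constant z₀. (Fatou: the iterates cannot tend to an irrationally indifferent fixed point in an invariant domain.) -/
open Filter Set

theorem bloch_aux (H : ℂ → ℂ) (c : ℂ) (R : ℝ) (hR : 0 < R)
    (hH : DifferentiableOn ℂ H (Metric.ball c R)) :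
    ∃ p ∈ Metric.ball c R,
      Metric.ball (H p) (R * ‖deriv H c‖ / 96) ⊆ H '' Metric.ball c R := by
  by_cases h0 : deriv H c = 0
  · exact ⟨c, Metric.mem_ball_self hR, by simp [h0]⟩
  have hc0 : 0 < ‖deriv H c‖ := norm_pos_iff.2 h0
  have hdH : DifferentiableOn ℂ (deriv H) (Metric.ball c R) := hH.deriv Metric.isOpen_ball
  have hsub : Metric.closedBall c (R/2) ⊆ Metric.ball c R :=
    Metric.closedBall_subset_ball (by linarith)
  obtain ⟨p, hp, hmax⟩ := (isCompact_closedBall c (R/2)).exists_isMaxOn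
    (f := fun z => ‖deriv H z‖ * (R/2 - dist z c))
    ⟨c, Metric.mem_closedBall_self (by linarith)⟩
    (((hdH.continuousOn.mono hsub).norm).mul (by fun_prop))
  have hmax' : ∀ z, dist z c ≤ R/2 →
      ‖deriv H z‖ * (R/2 - dist z c) ≤ ‖deriv H p‖ * (R/2 - dist p c) := fun z hz => hmax hz
  set M := ‖deriv H p‖ with hM
  obtain ⟨t, ht⟩ : ∃ t, t = (R/2 - dist p c)/2 := ⟨_, rfl⟩
  have hpc : dist p c ≤ R/2 := hp
  have h1 := hmax' c (by simp; linarith)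
  rw [dist_self] at h1
  have hM0 : 0 ≤ M := norm_nonneg _
  have hprod : 0 < M * t := by
    have : 0 < ‖deriv H c‖ * (R/2 - 0) := by apply mul_pos hc0; linarith
    rw [ht]; nlinarith
  have ht0 : 0 < t := by
    have : 0 ≤ t := by rw [ht]; linarith
    rcases this.eq_or_lt with h | h
    · rw [← h] at hprod; simp at hprod
    · exact h
  have hMpos : 0 < M := by
    rcases hM0.eq_or_lt with h | h
    · rw [← h] at hprod; simp at hprod
    · exact h
  have hballsub : Metric.ball p t ⊆ Metric.ball c R := by
    apply Metric.ball_subset_ball'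
    linarith
  have hbd : ∀ z ∈ Metric.ball p t, ‖deriv H z‖ ≤ 2 * M := by
    intro z hz
    have hz' : dist z p < t := hz
    have htri := dist_triangle z p c
    have h2 := hmax' z (by linarith)
    have h3 : t ≤ R/2 - dist z c := by linarith
    have h4 : ‖deriv H z‖ * t ≤ 2 * M * t := by
      calc ‖deriv H z‖ * t ≤ ‖deriv H z‖ * (R/2 - dist z c) := by gcongr
        _ ≤ _ := h2
        _ = 2 * M * t := by rw [ht]; ring
    exact le_of_mul_le_mul_right h4 ht0
  have hsch : ∀ z ∈ Metric.ball p t, dist (deriv H z) (deriv H p) ≤ 3 * M / t * dist z p := by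
    intro z hz
    apply Complex.dist_le_div_mul_dist_of_mapsTo_ball (hdH.mono hballsub) _ hz
    intro w hw
    rw [Metric.mem_closedBall, dist_eq_norm]
    have := norm_sub_le (deriv H w) (deriv H p)
    have := hbd w hw
    linarith
  have hat : ∀ z ∈ Metric.ball c R, DifferentiableAt ℂ H z := fun z hz =>
    hH.differentiableAt (Metric.isOpen_ball.mem_nhds hz)
  have hsm : Metric.closedBall p (t/6) ⊆ Metric.ball p t :=
    Metric.closedBall_subset_ball (by linarith)
  have hmv : ∀ z ∈ Metric.closedBall p (t/6),
      ‖(H z - deriv H p * z) - (H p - deriv H p * p)‖ ≤ M/2 * ‖z - p‖ := by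
    intro z hz
    refine Convex.norm_image_sub_le_of_norm_hasDerivWithin_le
      (f := fun z => H z - deriv H p * z) (f' := fun z => deriv H z - deriv H p)
      (s := Metric.closedBall p (t/6)) ?_ ?_ (convex_closedBall _ _)
      (Metric.mem_closedBall_self (by linarith)) hz
    · intro x hx
      have := ((hat x (hballsub (hsm hx))).hasDerivAt.fun_sub
        ((hasDerivAt_id x).const_mul (deriv H p))).hasDerivWithinAt (s := Metric.closedBall p (t/6))
      simpa using this
    · intro x hx
      have h5 := hsch x (hsm hx)
      have hx' : dist x p ≤ t/6 := hx
      rw [dist_eq_norm] at h5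
      calc _ ≤ 3 * M / t * dist x p := h5
        _ ≤ 3 * M / t * (t/6) := by gcongr
        _ = M/2 := by field_simp; norm_num
  have hlow : ∀ z ∈ Metric.closedBall p (t/6), M/2 * ‖z - p‖ ≤ ‖H z - H p‖ := by
    intro z hz
    have h6 := hmv z hz
    have h7 : deriv H p * (z - p) = (H z - H p) -
      ((H z - deriv H p * z) - (H p - deriv H p * p)) := by ring
    have h8 := norm_sub_le (H z - H p) ((H z - deriv H p * z) - (H p - deriv H p * p))
    rw [← h7, norm_mul, ← hM] at h8
    linarith
  have hfin := DiffContOnCl.ball_subset_image_closedBall (f := H) (z₀ := p) (r := t/6)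
    (ε := M * t / 12) ?_ (by linarith) ?_ ?_
  · refine ⟨p, hsub hp, ?_⟩
    refine (Metric.ball_subset_ball ?_).trans (hfin.trans (image_mono (hsm.trans hballsub)))
    have : M * (R/2 - dist p c) = 2 * (M * t) := by rw [ht]; ring
    linarith
  · exact (hH.mono ((Metric.closure_ball_subset_closedBall).trans (hsm.trans hballsub))).diffContOnCl
  · intro z hz
    have h9 := hlow z (Metric.sphere_subset_closedBall hz)
    rw [← dist_eq_norm, Metric.mem_sphere.1 hz] at h9
    linarith
  · apply Eventually.frequently (f := nhdsWithin p {p}ᶜ) _ |>.filter_mono nhdsWithin_le_nhds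
    have : Metric.closedBall p (t/6) ∈ nhdsWithin p {p}ᶜ :=
      nhdsWithin_le_nhds (Metric.closedBall_mem_nhds _ (by linarith))
    filter_upwards [this, self_mem_nhdsWithin] with z hz hne heq
    have h9 := hlow z hz
    rw [heq, sub_self, norm_zero] at h9
    have : 0 < ‖z - p‖ := norm_pos_iff.2 (sub_ne_zero.2 hne)
    have := mul_pos (half_pos hMpos) this
    linarith

theorem log_aux (G : ℂ → ℂ) (c : ℂ) (R : ℝ) (hR : 0 < R)
    (hG : DifferentiableOn ℂ G (Metric.ball c R)) (h0 : ∀ z ∈ Metric.ball c R, G z ≠ 0) :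
    ∃ H : ℂ → ℂ, DifferentiableOn ℂ H (Metric.ball c R) ∧
      ∀ z ∈ Metric.ball c R, G z = Complex.exp (H z) := by
  have hL : DifferentiableOn ℂ (fun z => deriv G z / G z) (Metric.ball c R) :=
    (hG.deriv Metric.isOpen_ball).div hG h0
  obtain ⟨H, hH⟩ := hL.isExactOn_ball.with_val_at c (Complex.log (G c))
  have hc := Metric.mem_ball_self (x := c) hR
  have hd : ∀ z ∈ Metric.ball c R, HasDerivAt (fun z => G z * Complex.exp (- H z)) 0 z := by
    intro z hz
    have h1 := (hG.differentiableAt (Metric.isOpen_ball.mem_nhds hz)).hasDerivAt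
    have h2 := h1.fun_mul (hH.2 z hz).neg.cexp
    refine h2.congr_deriv ?_
    have := h0 z hz
    have h3 : deriv G z / G z * G z = deriv G z := div_mul_cancel₀ _ this
    linear_combination (-Complex.exp (-H z)) * h3
  refine ⟨H, fun z hz => (hH.2 z hz).differentiableAt.differentiableWithinAt, fun z hz => ?_⟩
  have := Convex.norm_image_sub_le_of_norm_hasDerivWithin_le (C := 0)
    (fun x hx => (hd x hx).hasDerivWithinAt) (by simp) (convex_ball c R) hc hz
  rw [zero_mul, norm_le_zero_iff, sub_eq_zero, hH.1, Complex.exp_neg, Complex.exp_neg,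
    Complex.exp_log (h0 c hc), mul_inv_cancel₀ (h0 c hc)] at this
  exact (mul_inv_eq_one₀ (Complex.exp_ne_zero _)).1 this

theorem recur_aux (l : ℂ) (hl : ‖l‖ = 1) (W : Set ℂ) (hW : W ∈ nhds (1:ℂ)) (Q : ℕ) :
    ∃ q ≥ Q, l ^ q ∈ W := by
  have h := mapClusterPt_one_atTop_pow (G := Circle) ⟨l, mem_sphere_zero_iff_norm.2 hl⟩
  have hW' : (fun x : Circle => (x : ℂ)) ⁻¹' W ∈ nhds (1 : Circle) := by
    apply (continuous_subtype_val : Continuous (fun x : Circle => (x : ℂ))).continuousAt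
    simpa using hW
  obtain ⟨q, hq, hq'⟩ := (mapClusterPt_iff_frequently.1 h _ hW').forall_exists_of_atTop Q
  exact ⟨q, hq, hq'⟩

theorem local_aux (V : Set ℂ) (hV : IsOpen V) (f : ℂ → ℂ) (hf : DifferentiableOn ℂ f V)
    (hm : MapsTo f V V) (hinj : InjOn f V) (z₀ : ℂ) (hz : z₀ ∉ V) (hfix : f z₀ = z₀)
    (hu : TendstoUniformlyOn (fun n z => f^[n] z) (fun _ => z₀) atTop V)
    (l : ℂ) (hl : ‖l‖ = 1) (hd : HasDerivAt f l z₀) (a : ℂ) (ha : a ∈ V) :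
    ∀ᶠ z in nhds a, Tendsto (fun n => (f^[n] z - z₀) / (f^[n] a - z₀)) atTop (nhds 1) := by
  have hmn : ∀ n, MapsTo f^[n] V V := fun n => hm.iterate n
  have hin : ∀ n, InjOn f^[n] V := fun n => hinj.iterate hm n
  have hne : ∀ n, ∀ z ∈ V, f^[n] z - z₀ ≠ 0 := fun n z hzV h0 => by
    have := hmn n hzV
    rw [sub_eq_zero.1 h0] at this
    exact hz this
  have haz : 0 < dist a z₀ := dist_pos.2 (fun h => hz (h ▸ ha))
  obtain ⟨r, hr0, hrV, hrd⟩ : ∃ r > 0, Metric.ball a r ⊆ V ∧ r ≤ dist a z₀ / 2 := by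
    obtain ⟨r, hr0, hr⟩ := Metric.isOpen_iff.1 hV a ha
    exact ⟨min r (dist a z₀ / 2), lt_min hr0 (by linarith),
      (Metric.ball_subset_ball (min_le_left _ _)).trans hr, min_le_right _ _⟩
  choose H hHd hHe using fun n => log_aux (fun z => f^[n] z - z₀) a r hr0
    (((hf.iterate hm n).mono hrV).sub_const z₀) (fun z hz => hne n z (hrV hz))
  have key : ∀ ε > 0, ∀ᶠ n in atTop, ∀ z ∈ Metric.ball a (r/2), ‖deriv (H n) z‖ < ε := by
    intro ε hε
    set δ := (r/2) * ε / 96 with hδ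
    have hδ0 : 0 < δ := by positivity
    have hW : {w : ℂ | w ≠ 0 ∧ ‖Complex.log w‖ < δ} ∈ nhds (1:ℂ) := by
      have h1 : ContinuousAt (fun w => ‖Complex.log w‖) 1 :=
        (continuousAt_clog (by simp)).norm
      have h2 : ∀ᶠ w in nhds (1:ℂ), ‖Complex.log w‖ < δ :=
        h1.eventually_lt continuousAt_const (by simpa using hδ0)
      filter_upwards [h2, isOpen_ne.mem_nhds one_ne_zero] with w h h' using ⟨h', h⟩
    obtain ⟨Q, hQ⟩ := eventually_atTop.1
      (Metric.tendstoUniformlyOn_iff.1 hu (dist a z₀ / 2) (by linarith))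
    obtain ⟨q, hqQ, hq⟩ := recur_aux l hl _ (interior_mem_nhds.2 hW) Q
    have hdq := hasDerivAt_iff_tendsto_slope.1 (HasDerivAt.iterate z₀ hd hfix q)
    have h3 := hdq (isOpen_interior.mem_nhds hq)
    rw [mem_map, mem_nhdsWithin_iff_eventually, Metric.eventually_nhds_iff] at h3
    obtain ⟨η, hη, h3⟩ := h3
    filter_upwards [Metric.tendstoUniformlyOn_iff.1 hu η hη] with n hn z hzb
    by_contra! hcon
    have hsub : Metric.ball z (r/2) ⊆ Metric.ball a r := by
      apply Metric.ball_subset_ball'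
      have := Metric.mem_ball.1 hzb
      linarith
    obtain ⟨p, hp, hpb⟩ := bloch_aux (H n) z (r/2) (by linarith) ((hHd n).mono hsub)
    have hpV := hrV (hsub hp)
    have h4 := hn p hpV
    rw [dist_comm] at h4
    have h5 := interior_subset (h3 h4 (sub_ne_zero.1 (hne n p hpV)))
    have hfixq : f^[q] z₀ = z₀ := Function.iterate_fixed hfix q
    simp only [slope_def_field, hfixq, mem_ofPred_eq] at h5
    set w := (f^[q] (f^[n] p) - z₀) / (f^[n] p - z₀) with hw
    obtain ⟨h5, h6⟩ := h5
    have h7 : H n p + Complex.log w ∈ Metric.ball (H n p) (r/2 * ‖deriv (H n) z‖ / 96) := by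
      rw [Metric.mem_ball, dist_eq_norm, add_sub_cancel_left]
      refine h6.trans_le ?_
      rw [hδ]; gcongr
    obtain ⟨y, hy, hyH⟩ := hpb h7
    have h8 := hHe n y (hsub hy)
    rw [hyH, Complex.exp_add, Complex.exp_log h5, ← hHe n p (hsub hp), hw,
      mul_div_cancel₀ _ (hne n p hpV), sub_left_inj, ← Function.iterate_add_apply, add_comm,
      Function.iterate_add_apply] at h8
    have h9 := hin n (hrV (hsub hy)) (hmn q hpV) h8
    have h10 := hQ q hqQ p hpV
    rw [← h9] at h10
    have h11 : dist y a < r := hsub hy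
    have := dist_triangle_left a z₀ y
    rw [dist_comm y z₀] at this
    linarith
  filter_upwards [Metric.ball_mem_nhds a (half_pos hr0)] with z hzb
  have hss : Metric.ball a (r/2) ⊆ Metric.ball a r := Metric.ball_subset_ball (by linarith)
  have hab : a ∈ Metric.ball a (r/2) := Metric.mem_ball_self (half_pos hr0)
  have hlim : Tendsto (fun n => H n z - H n a) atTop (nhds 0) := by
    rw [Metric.tendsto_nhds]
    intro ε hε
    filter_upwards [key (ε / r) (by positivity)] with n hn
    have := Convex.norm_image_sub_le_of_norm_deriv_le (f := H n) (C := ε / r)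
      (fun x hx => (hHd n).differentiableAt (Metric.isOpen_ball.mem_nhds (hss hx)))
      (fun x hx => (hn x hx).le) (convex_ball a (r/2)) hab hzb
    rw [dist_zero_right]
    have h1 : ‖z - a‖ < r := by rw [← dist_eq_norm]; exact hss hzb
    calc _ ≤ ε / r * ‖z - a‖ := this
      _ < ε / r * r := by gcongr
      _ = ε := by field_simp
  have h2 := (Complex.continuous_exp.tendsto 0).comp hlim
  rw [Complex.exp_zero] at h2
  refine h2.congr fun n => ?_
  rw [Function.comp_apply, Complex.exp_sub, ← hHe n z (hss hzb), ← hHe n a (hss hab)]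

/-- Fatou: the iterates of a holomorphic map cannot converge uniformly to an
irrationally indifferent fixed point on an invariant domain. -/
theorem no_invariant_domain_converging_to_cremer_point
    (U : Set ℂ) (hU : IsOpen U) (f : ℂ → ℂ) (hf : DifferentiableOn ℂ f U)
    (z₀ : ℂ) (hz₀ : z₀ ∈ U) (hfix : f z₀ = z₀)
    (α : ℝ) (hα : Irrational α)
    (hmult : deriv f z₀ = Complex.exp (2 * Real.pi * Complex.I * (α : ℂ))) :
    ¬ ∃ D : Set ℂ, D.Nonempty ∧ IsOpen D ∧ IsConnected D ∧ D ⊆ U ∧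
        MapsTo f D D ∧
        TendstoUniformlyOn (fun n z => f^[n] z) (fun _ => z₀) atTop D := by
  rintro ⟨D, ⟨x₀, hx₀⟩, hDo, hDc, hDU, hm, hu⟩
  set l := deriv f z₀ with hldef
  have hl : ‖l‖ = 1 := by
    rw [hmult, Complex.norm_exp]
    simp
  have hl1 : l ≠ 1 := by
    rw [hmult]
    intro h
    obtain ⟨n, hn⟩ := Complex.exp_eq_one_iff.1 h
    have h2 : (2 * Real.pi * Complex.I : ℂ) ≠ 0 := Complex.two_pi_I_ne_zero
    rw [mul_comm (n : ℂ)] at hn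
    have h3 : (α : ℂ) = n := mul_left_cancel₀ h2 hn
    have h4 : α = n := by exact_mod_cast h3
    exact hα.ne_int n h4
  have hfat : AnalyticAt ℂ f z₀ := hf.analyticAt (hU.mem_nhds hz₀)
  have hd : HasDerivAt f l z₀ := hfat.differentiableAt.hasDerivAt
  have hl0 : l ≠ 0 := by rw [← norm_pos_iff, hl]; exact one_pos
  have hmn : ∀ n, MapsTo f^[n] D D := fun n => hm.iterate n
  have hfD := hf.mono hDU
  have hdn : ∀ n, DifferentiableOn ℂ f^[n] D := fun n => hfD.iterate hm n
  have hzD : z₀ ∉ D := by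
    intro hzD
    obtain ⟨r, hr0, hr⟩ := Metric.isOpen_iff.1 hDo z₀ hzD
    have hsub : Metric.closedBall z₀ (r/2) ⊆ D :=
      (Metric.closedBall_subset_ball (by linarith)).trans hr
    obtain ⟨n, hn⟩ := (Metric.tendstoUniformlyOn_iff.1 hu (r/4) (by linarith)).exists
    have h1 := (HasDerivAt.iterate z₀ hd hfix n).sub_const z₀
    have h2 := Complex.norm_deriv_le_of_forall_mem_sphere_norm_le (c := z₀) (R := r/2) (C := r/4)
      (f := fun z => f^[n] z - z₀) (by linarith)
      ((((hdn n).sub_const z₀).mono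
        (Metric.closure_ball_subset_closedBall.trans hsub)).diffContOnCl) (fun z hz => by
          have := hn z (hsub (Metric.sphere_subset_closedBall hz))
          rw [dist_comm, dist_eq_norm] at this
          exact this.le)
    rw [h1.deriv, norm_pow, hl, one_pow] at h2
    have h3 : r / 4 / (r / 2) = 1 / 2 := by field_simp; norm_num
    rw [h3] at h2
    norm_num at h2
  obtain ⟨B, hzB, hBo, hBinj⟩ : ∃ B : Set ℂ, z₀ ∈ B ∧ IsOpen B ∧ InjOn f B := by
    have hs : HasStrictDerivAt f l z₀ := hfat.hasStrictDerivAt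
    have hs' := hs.hasStrictFDerivAt_equiv hl0
    obtain ⟨s, h1, h2, h3⟩ := hs'.approximates_deriv_on_open_nhds
    refine ⟨s, h1, h2, h3.injOn (Or.inr ?_)⟩
    apply half_lt_self
    apply inv_pos.2
    exact (ContinuousLinearEquiv.nnnorm_symm_pos _)
  obtain ⟨ρ, hρ, hρB⟩ := Metric.isOpen_iff.1 hBo z₀ hzB
  obtain ⟨N, hN⟩ := eventually_atTop.1 (Metric.tendstoUniformlyOn_iff.1 hu ρ hρ)
  have hNB : ∀ n ≥ N, ∀ z ∈ D, f^[n] z ∈ B := fun n hn z hz => hρB (by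
    rw [Metric.mem_ball, dist_comm]; exact hN n hn z hz)
  set V : Set ℂ := ⋂ n ∈ Finset.range (N+1), (D ∩ f^[n] ⁻¹' B) with hVdef
  have hVmem : ∀ z, z ∈ V ↔ z ∈ D ∧ ∀ n, f^[n] z ∈ B := by
    intro z
    simp only [hVdef, mem_iInter, Finset.mem_range, mem_inter_iff, mem_preimage]
    constructor
    · intro h
      refine ⟨(h 0 (by omega)).1, fun n => ?_⟩
      by_cases hn : n < N + 1
      · exact (h n hn).2
      · exact hNB n (by omega) z (h 0 (by omega)).1
    · exact fun h n _ => ⟨h.1, h.2 n⟩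
  have hVo : IsOpen V := isOpen_biInter_finset fun n _ =>
    (hdn n).continuousOn.isOpen_inter_preimage hDo hBo
  have hVD : V ⊆ D := fun z hz => ((hVmem z).1 hz).1
  have hVm : MapsTo f V V := fun z hz => by
    have := (hVmem z).1 hz
    exact (hVmem _).2 ⟨hm this.1, fun n => by
      rw [← Function.iterate_succ_apply]; exact this.2 (n+1)⟩
  have hVinj : InjOn f V := hBinj.mono fun z hz => ((hVmem z).1 hz).2 0
  have hloc := local_aux V hVo f (hfD.mono hVD) hVm hVinj z₀ (fun h => hzD (hVD h)) hfix
    (hu.mono hVD) l hl hd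
  set S := f^[N] '' D with hS
  have hSc : IsPreconnected S := hDc.isPreconnected.image _ (hdn N).continuousOn
  have hSV : S ⊆ V := by
    rintro _ ⟨z, hz, rfl⟩
    refine (hVmem _).2 ⟨hmn N hz, fun n => ?_⟩
    rw [← Function.iterate_add_apply]
    exact hNB _ (by omega) z hz
  have hne : ∀ n, ∀ z ∈ S, f^[n] z - z₀ ≠ 0 := fun n z hzS h0 => by
    have := hmn n (hVD (hSV hzS))
    rw [sub_eq_zero.1 h0] at this
    exact hzD this
  have hx : f^[N] x₀ ∈ S := ⟨x₀, hx₀, rfl⟩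
  have hfx : f (f^[N] x₀) ∈ S := ⟨f x₀, hm hx₀, by
    rw [← Function.iterate_succ_apply, Function.iterate_succ_apply']⟩
  have hP := hSc.induction₂
    (fun x y => Tendsto (fun n => (f^[n] y - z₀) / (f^[n] x - z₀)) atTop (nhds 1))
    (fun x hx => (hloc x (hSV hx)).filter_mono nhdsWithin_le_nhds)
    (fun x y z hx hy hz hxy hyz => by
      have h := hyz.mul hxy
      rw [one_mul] at h
      refine h.congr fun n => ?_
      rw [div_mul_div_cancel₀ (hne n y hy)])
    (fun x y hx hy hxy => by
      have h := hxy.inv₀ one_ne_zero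
      rw [inv_one] at h
      exact h.congr fun n => by rw [inv_div])
    hx hfx
  set x := f^[N] x₀ with hxdef
  have hto : Tendsto (fun n => f^[n] x) atTop (nhdsWithin z₀ {z₀}ᶜ) := by
    refine tendsto_nhdsWithin_iff.2 ⟨hu.tendsto_at (hVD (hSV hx)), ?_⟩
    exact Eventually.of_forall fun n => sub_ne_zero.1 (hne n x hx)
  have hlam := (hasDerivAt_iff_tendsto_slope.1 hd).comp hto
  refine hl1 (tendsto_nhds_unique (hlam.congr fun n => ?_) hP)
  rw [Function.comp_apply, slope_def_field, hfix, ← Function.iterate_succ_apply' f,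
    Function.iterate_succ_apply]
end

section
/- Let α ∈ ℝ satisfy a Diophantine condition: there exist c > 0 and τ > 0 such that |α − p/q| > c/q^τ for every p ∈ ℤ and every integer q ≥ 1. Then the quadratic polynomial P_α(z) = z² + e^{2πiα}z is linearizable at its fixed point 0: there exist r > 0 and an injective holomorphic map h on the disk D(0,r) = {z : |z| < r} with h(0) = 0 such that P_α(h(z)) = h(e^{2πiα}·z) for all z ∈ D(0,r). (Siegel's linearization theorem for the quadratic family.) -/
open Metric

namespace SiegelQuad

/-- Binary trees. -/
inductive BT : Type
  | leaf : BT
  | node : BT → BT → BT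

/-- Number of internal nodes. -/
def BT.sz : BT → ℕ
  | .leaf => 0
  | .node l r => l.sz + r.sz + 1

open Classical in
/-- Number of bad internal nodes. -/
noncomputable def BT.cnt (Bad : ℕ → Prop) : BT → ℕ
  | .leaf => 0
  | .node l r => l.cnt Bad + r.cnt Bad + if Bad (l.sz + r.sz + 1) then 1 else 0

/-- Product of inverse small divisors. -/
noncomputable def BT.wt (e : ℕ → ℝ) : BT → ℝ
  | .leaf => 1
  | .node l r => (e (l.sz + r.sz + 1))⁻¹ * (l.wt e * r.wt e)

/-- Brjuno's counting lemma. -/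
theorem cnt_bound (Bad : ℕ → Prop) (q : ℕ) (h1 : ∀ k, Bad k → q ≤ k)
    (h2 : ∀ k k', Bad k → Bad k' → k' < k → q ≤ k - k') (T : BT) :
    (T.cnt Bad = 0 ∨ q * (T.cnt Bad + 1) ≤ 2 * (T.sz + 1)) ∧
    ∀ K, Bad K → T.sz < K → q * (T.cnt Bad + 2) ≤ 2 * (K + 1) := by
  induction T with
  | leaf =>
    refine ⟨Or.inl rfl, fun K hK _ => ?_⟩
    have := h1 K hK
    simp only [BT.cnt]
    omega
  | node l r ihl ihr =>
    obtain ⟨ml, cl⟩ := ihl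
    obtain ⟨mr, cr⟩ := ihr
    have main : ((BT.node l r).cnt Bad = 0 ∨
        q * ((BT.node l r).cnt Bad + 1) ≤ 2 * ((BT.node l r).sz + 1)) := by
      simp only [BT.cnt, BT.sz]
      by_cases hb : Bad (l.sz + r.sz + 1)
      · right
        rw [if_pos hb]
        rcases ml with ml | ml
        · have := cr _ hb (by omega)
          rw [ml]; simpa [add_assoc] using this
        · rcases mr with mr | mr
          · have := cl _ hb (by omega)
            rw [mr]; simpa [add_assoc] using this
          · nlinarith
      · rw [if_neg hb]
        rcases ml with ml | ml
        · rcases mr with mr | mr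
          · left; omega
          · right; rw [ml]; simp only [zero_add, add_zero]; omega
        · rcases mr with mr | mr
          · right; rw [mr]; simp only [add_zero]; omega
          · right; nlinarith
    refine ⟨main, fun K hK hlt => ?_⟩
    have hqK := h1 K hK
    by_cases hb : Bad (l.sz + r.sz + 1)
    · have hq := h2 K _ hK hb hlt
      rcases main with m | m
      · rw [m]; omega
      · simp only [BT.sz] at hlt m hq
        have : q * ((BT.node l r).cnt Bad + 2) = q * ((BT.node l r).cnt Bad + 1) + q := by ring
        omega
    · simp only [BT.sz] at hlt
      have e : (BT.node l r).cnt Bad = l.cnt Bad + r.cnt Bad := by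
        simp only [BT.cnt, if_neg hb, add_zero]
      rw [e]
      rcases ml with ml | ml
      · have := cr K hK (by omega)
        rw [ml]; simpa using this
      · rcases mr with mr | mr
        · have := cl K hK (by omega)
          rw [mr]; simpa using this
        · nlinarith

open Classical in
/-- Uniform exponential bound for the weights of trees. -/
theorem wt_bound (e : ℕ → ℝ) (C : ℝ) (hC : 0 < C) (ν : ℕ)
    (he : ∀ k : ℕ, 1 ≤ k → 1 ≤ C * (k : ℝ) ^ ν * e k)
    (hsub : ∀ k k', k' < k → e (k - k') ≤ e k + e k') (T : BT) :
    T.wt e ≤ (2 * C) ^ T.sz * ((2 : ℝ) ^ ν) ^ (4 * (T.sz + 1)) := by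
  set R : ℝ := 2 ^ ν with hR
  have hR1 : 1 ≤ R := one_le_pow₀ (by norm_num)
  have hpos : ∀ k, 1 ≤ k → 0 < e k := by
    intro k hk
    by_contra hn
    have : C * (k : ℝ) ^ ν * e k ≤ 0 := mul_nonpos_of_nonneg_of_nonpos (by positivity) (by linarith)
    linarith [he k hk]
  -- bad at level `m`
  let Bad : ℕ → ℕ → Prop := fun m k => 1 ≤ k ∧ 2 * C * R ^ m * e k < 1
  have hlow : ∀ m k, 1 ≤ k → k < 2 ^ m → 1 ≤ C * R ^ m * e k := by
    intro m k hk hkm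
    refine (he k hk).trans ?_
    have hp := hpos k hk
    have : (k : ℝ) ^ ν ≤ R ^ m := by
      rw [hR, ← pow_mul, mul_comm, pow_mul]
      have : (k : ℝ) ≤ 2 ^ m := by exact_mod_cast hkm.le
      gcongr
    gcongr
  have b1 : ∀ m k, Bad m k → 2 ^ m ≤ k := by
    rintro m k ⟨hk, hb⟩
    by_contra hn
    have := hlow m k hk (by omega)
    linarith
  have b2 : ∀ m k k', Bad m k → Bad m k' → k' < k → 2 ^ m ≤ k - k' := by
    rintro m k k' ⟨hk, hb⟩ ⟨hk', hb'⟩ hlt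
    by_contra hn
    have := hlow m (k - k') (by omega) (by omega)
    have h3 : C * R ^ m * e (k - k') ≤ C * R ^ m * (e k + e k') := by
      have := hsub k k' hlt
      gcongr
    linarith
  have key : ∀ L T, BT.sz T ≤ L →
      0 ≤ T.wt e ∧ T.wt e ≤ (2 * C) ^ T.sz * R ^ (∑ m ∈ Finset.range L, T.cnt (Bad m)) := by
    intro L T
    induction T with
    | leaf => intro _; simp [BT.wt, BT.sz, BT.cnt]
    | node l r ihl ihr =>
      intro hL
      simp only [BT.sz] at hL
      obtain ⟨l0, l1⟩ := ihl (by omega)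
      obtain ⟨r0, r1⟩ := ihr (by omega)
      set k := l.sz + r.sz + 1 with hk
      have hp := hpos k (by omega)
      have hinv : (e k)⁻¹ ≤ (2 * C) * R ^ (∑ m ∈ Finset.range L, if Bad m k then 1 else 0) := by
        rw [inv_le_iff_one_le_mul₀ hp]
        have hex : ∃ m, ¬ Bad m k := ⟨L, fun hb => by
          have := b1 L k hb
          have := @Nat.lt_two_pow_self L
          omega⟩
        have hML : Nat.find hex ≤ L := Nat.find_min' hex (fun hb => by
          have := b1 L k hb
          have := @Nat.lt_two_pow_self L
          omega)
        have hM := Nat.find_spec hex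
        have hmin := fun m hm => not_not.1 (Nat.find_min hex (m := m) hm)
        set M := Nat.find hex
        have hsum : M ≤ ∑ m ∈ Finset.range L, if Bad m k then 1 else 0 := by
          calc M = ∑ m ∈ Finset.range M, 1 := by simp
            _ = ∑ m ∈ Finset.range M, if Bad m k then 1 else 0 :=
                Finset.sum_congr rfl (fun m hm => by
                  rw [if_pos (hmin m (Finset.mem_range.1 hm))])
            _ ≤ _ := Finset.sum_le_sum_of_subset (Finset.range_mono hML)
        have h4 : 1 ≤ 2 * C * R ^ M * e k := by
          by_contra hn
          exact hM ⟨by omega, not_le.1 hn⟩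
        refine h4.trans ?_
        have := pow_le_pow_right₀ hR1 hsum
        convert mul_le_mul_of_nonneg_right (mul_le_mul_of_nonneg_left this (show 0 ≤ 2 * C by positivity)) hp.le
      refine ⟨by simp only [BT.wt]; positivity, ?_⟩
      simp only [BT.wt, BT.sz, BT.cnt, Finset.sum_add_distrib, ← hk]
      have hk2 : (2 * C) ^ k = (2 * C) ^ l.sz * (2 * C) ^ r.sz * (2 * C) := by
        rw [hk, pow_succ, pow_add]
      calc (e k)⁻¹ * (l.wt e * r.wt e)
          ≤ ((2 * C) * R ^ (∑ m ∈ Finset.range L, if Bad m k then 1 else 0)) *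
            (((2 * C) ^ l.sz * R ^ (∑ m ∈ Finset.range L, l.cnt (Bad m))) *
             ((2 * C) ^ r.sz * R ^ (∑ m ∈ Finset.range L, r.cnt (Bad m)))) := by gcongr
        _ = _ := by rw [hk2, pow_add, pow_add]; ring
  obtain ⟨_, hT⟩ := key T.sz T le_rfl
  refine hT.trans ?_
  have hsum : ∑ m ∈ Finset.range T.sz, T.cnt (Bad m) ≤ 4 * (T.sz + 1) := by
    have hr : ((∑ m ∈ Finset.range T.sz, T.cnt (Bad m) : ℕ) : ℝ) ≤ 4 * (T.sz + 1) := by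
      push_cast
      calc ∑ m ∈ Finset.range T.sz, (T.cnt (Bad m) : ℝ)
          ≤ ∑ m ∈ Finset.range T.sz, (2 * (T.sz + 1) : ℝ) * (1 / 2) ^ m := by
            refine Finset.sum_le_sum fun m _ => ?_
            have h5 : 2 ^ m * T.cnt (Bad m) ≤ 2 * (T.sz + 1) := by
              rcases (cnt_bound (Bad m) (2 ^ m) (b1 m) (b2 m) T).1 with h | h
              · rw [h]; omega
              · exact le_trans (Nat.mul_le_mul_left _ (Nat.le_succ _)) h
            have h6 : (2 : ℝ) ^ m * T.cnt (Bad m) ≤ 2 * (T.sz + 1) := by exact_mod_cast h5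
            rw [one_div, inv_pow, ← div_eq_mul_inv, le_div_iff₀ (by positivity)]
            linarith
        _ = (2 * (T.sz + 1) : ℝ) * ∑ m ∈ Finset.range T.sz, (1 / (2 : ℝ)) ^ m := by
            rw [Finset.mul_sum]
        _ ≤ (2 * (T.sz + 1) : ℝ) * 2 := by
            have := sum_geometric_two_le T.sz
            gcongr
        _ = _ := by ring
    exact_mod_cast hr
  gcongr

/-- Coefficients of the linearization. -/
noncomputable def coef (lam : ℂ) : ℕ → ℂ
  | 0 => 1
  | n + 1 => (lam * (lam ^ (n + 1) - 1))⁻¹ *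
      ∑ i : Fin n.succ, coef lam i * coef lam (n - i)

theorem coef_zero (lam : ℂ) : coef lam 0 = 1 := by rw [coef]

theorem coef_succ (lam : ℂ) (n : ℕ) : coef lam (n + 1) = (lam * (lam ^ (n + 1) - 1))⁻¹ *
      ∑ p ∈ Finset.HasAntidiagonal.antidiagonal n, coef lam p.1 * coef lam p.2 := by
  rw [coef, Finset.Nat.sum_antidiagonal_eq_sum_range_succ (fun x y => coef lam x * coef lam y),
    Finset.sum_range]

theorem coef_tree (lam : ℂ) (hl : ‖lam‖ = 1) (n : ℕ) :
    ∃ T : BT, T.sz = n ∧ ‖coef lam n‖ ≤ catalan n * T.wt (fun k => ‖lam ^ k - 1‖) := by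
  induction n using Nat.strong_induction_on with
  | _ n ih =>
    cases n with
    | zero => exact ⟨.leaf, rfl, by simp [coef_zero, BT.wt]⟩
    | succ n =>
      have ih' : ∀ i, ∃ T : BT, i < n + 1 → T.sz = i ∧
          ‖coef lam i‖ ≤ catalan i * T.wt (fun k => ‖lam ^ k - 1‖) := by
        intro i
        by_cases h : i < n + 1
        · obtain ⟨T, hT⟩ := ih i h
          exact ⟨T, fun _ => hT⟩
        · exact ⟨.leaf, fun h' => absurd h' h⟩
      choose t ht using ih'
      obtain ⟨p, hp, hmax⟩ := Finset.exists_max_image (Finset.HasAntidiagonal.antidiagonal n)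
        (fun p => (t p.1).wt (fun k => ‖lam ^ k - 1‖) * (t p.2).wt (fun k => ‖lam ^ k - 1‖))
        ⟨(0, n), by simp⟩
      have hpn := Finset.HasAntidiagonal.mem_antidiagonal.1 hp
      have s1 := (ht p.1 (by omega)).1
      have s2 := (ht p.2 (by omega)).1
      refine ⟨.node (t p.1) (t p.2), by simp only [BT.sz]; omega, ?_⟩
      rw [coef_succ, catalan_succ', norm_mul, norm_inv, norm_mul, hl, one_mul]
      simp only [BT.wt]
      rw [s1, s2, hpn]
      have : ‖∑ p ∈ Finset.HasAntidiagonal.antidiagonal n, coef lam p.1 * coef lam p.2‖ ≤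
          ∑ x ∈ Finset.HasAntidiagonal.antidiagonal n, ((catalan x.1 * catalan x.2 : ℕ) : ℝ) *
            ((t p.1).wt (fun k => ‖lam ^ k - 1‖) * (t p.2).wt (fun k => ‖lam ^ k - 1‖)) := by
        refine (norm_sum_le _ _).trans (Finset.sum_le_sum fun x hx => ?_)
        have hxn := Finset.HasAntidiagonal.mem_antidiagonal.1 hx
        have a1 := (ht x.1 (by omega)).2
        have a2 := (ht x.2 (by omega)).2
        rw [norm_mul]
        calc _ ≤ _ := mul_le_mul a1 a2 (norm_nonneg _) ((norm_nonneg _).trans a1)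
          _ = ((catalan x.1 * catalan x.2 : ℕ) : ℝ) *
            ((t x.1).wt (fun k => ‖lam ^ k - 1‖) * (t x.2).wt (fun k => ‖lam ^ k - 1‖)) := by
              push_cast; ring
          _ ≤ _ := mul_le_mul_of_nonneg_left (hmax x hx) (Nat.cast_nonneg _)
      rw [← Finset.sum_mul] at this
      calc _ ≤ _ := mul_le_mul_of_nonneg_left this (inv_nonneg.2 (norm_nonneg _))
        _ = _ := by push_cast; ring

theorem catalan_le (n : ℕ) : catalan n ≤ 4 ^ n := by
  have h1 := succ_mul_catalan_eq_centralBinom n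
  have h2 := Nat.centralBinom_le_four_pow n
  nlinarith [Nat.zero_le (n * catalan n)]

theorem coef_bound (lam : ℂ) (hl : ‖lam‖ = 1) (C : ℝ) (hC : 0 < C) (ν : ℕ)
    (he : ∀ k : ℕ, 1 ≤ k → 1 ≤ C * (k : ℝ) ^ ν * ‖lam ^ k - 1‖) :
    ∃ A : ℝ, 0 < A ∧ ∃ B : ℝ, 0 < B ∧ ∀ n, ‖coef lam n‖ ≤ B * A ^ n := by
  refine ⟨4 * (2 * C) * ((2 : ℝ) ^ ν) ^ 4, by positivity, ((2 : ℝ) ^ ν) ^ 4, by positivity,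
    fun n => ?_⟩
  obtain ⟨T, hT, hb⟩ := coef_tree lam hl n
  have hw := wt_bound (fun k => ‖lam ^ k - 1‖) C hC ν he (by
    intro k k' hlt
    have : lam ^ k - lam ^ k' = lam ^ k' * (lam ^ (k - k') - 1) := by
      rw [mul_sub, ← pow_add, mul_one]; congr 2; omega
    have h2 : ‖lam ^ (k - k') - 1‖ = ‖lam ^ k - lam ^ k'‖ := by
      rw [this, norm_mul, norm_pow, hl, one_pow, one_mul]
    rw [h2]
    calc ‖lam ^ k - lam ^ k'‖ = ‖(lam ^ k - 1) - (lam ^ k' - 1)‖ := by congr 1; ring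
      _ ≤ _ := norm_sub_le _ _) T
  rw [hT] at hw
  have hc : (catalan n : ℝ) ≤ 4 ^ n := by exact_mod_cast catalan_le n
  calc _ ≤ _ := hb
    _ ≤ (catalan n : ℝ) * ((2 * C) ^ n * ((2 : ℝ) ^ ν) ^ (4 * (n + 1))) := by gcongr
    _ ≤ 4 ^ n * ((2 * C) ^ n * ((2 : ℝ) ^ ν) ^ (4 * (n + 1))) := by gcongr
    _ = _ := by rw [pow_mul, pow_succ (((2 : ℝ) ^ ν) ^ 4)]; simp only [mul_pow]; ring

/-- The small divisor estimate. -/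
theorem small_div (α c τ : ℝ) (hc : 0 < c) (k : ℕ) (hk : 1 ≤ k) 
    (h : ∀ p : ℤ, ∀ q : ℕ, 1 ≤ q → c / (q : ℝ) ^ τ < |α - (p : ℝ) / (q : ℝ)|) :
    1 ≤ c⁻¹ * (k : ℝ) ^ (⌈τ⌉₊) *
      ‖Complex.exp (2 * Real.pi * Complex.I * (α : ℂ)) ^ k - 1‖ := by
  have hk1 : (1 : ℝ) ≤ k := by exact_mod_cast hk
  set p := round (k * α) with hp
  set y : ℝ := k * α - p with hy
  have hy2 : |y| ≤ 1 / 2 := abs_sub_round _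
  have e1 : Complex.exp (2 * Real.pi * Complex.I * (α : ℂ)) ^ k =
      Complex.exp (Complex.I * ((2 * Real.pi * y : ℝ) : ℂ)) := by
    rw [← Complex.exp_nat_mul, Complex.exp_eq_exp_iff_exists_int]
    refine ⟨p, ?_⟩
    rw [hy]; push_cast; ring
  have e2 : ‖Complex.exp (2 * Real.pi * Complex.I * (α : ℂ)) ^ k - 1‖ ≥ |y| := by
    rw [e1, Complex.norm_exp_I_mul_ofReal_sub_one, norm_mul, Real.norm_eq_abs, Real.norm_eq_abs,
      show 2 * Real.pi * y / 2 = Real.pi * y by ring]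
    have := Real.mul_abs_le_abs_sin (x := Real.pi * y) (by
      rw [abs_mul, abs_of_pos Real.pi_pos]
      nlinarith [Real.pi_pos])
    rw [abs_mul, abs_of_pos Real.pi_pos, ← mul_assoc, div_mul_cancel₀ _ Real.pi_ne_zero] at this
    rw [abs_of_pos (by norm_num : (0 : ℝ) < 2)]
    nlinarith [abs_nonneg y]
  have e3 : c / (k : ℝ) ^ ⌈τ⌉₊ ≤ |y| := by
    have h1 := h p k hk
    have h2 : (k : ℝ) ^ τ ≤ (k : ℝ) ^ ⌈τ⌉₊ := by
      rw [← Real.rpow_natCast]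
      exact Real.rpow_le_rpow_of_exponent_le hk1 (Nat.le_ceil τ)
    have h3 : |α - (p : ℝ) / k| ≤ |y| := by
      have : y = k * (α - p / k) := by rw [hy]; field_simp
      rw [this, abs_mul, abs_of_pos (show (0 : ℝ) < k by linarith)]
      nlinarith [abs_nonneg (α - (p : ℝ) / k)]
    refine le_trans ?_ (h1.le.trans h3)
    have : 0 < (k : ℝ) ^ τ := Real.rpow_pos_of_pos (by linarith) _
    gcongr
  have hkp : 0 < (k : ℝ) ^ ⌈τ⌉₊ := by positivity
  calc 1 = c⁻¹ * (k : ℝ) ^ (⌈τ⌉₊) * (c / (k : ℝ) ^ ⌈τ⌉₊) := by field_simp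
    _ ≤ _ := by have := e3.trans e2; gcongr

theorem finish (lam : ℂ) (hl : ‖lam‖ = 1) (hne : ∀ k : ℕ, 1 ≤ k → lam ^ k - 1 ≠ 0)
    (A B : ℝ) (hA : 0 < A) (hb : ∀ n, ‖coef lam n‖ ≤ B * A ^ n) :
    ∃ r : ℝ, 0 < r ∧ ∃ h : ℂ → ℂ,
      DifferentiableOn ℂ h (ball (0 : ℂ) r) ∧
      Set.InjOn h (ball (0 : ℂ) r) ∧
      h 0 = 0 ∧
      ∀ z ∈ ball (0 : ℂ) r, (h z) ^ 2 + lam * h z = h (lam * z) := by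
  have hl0 : lam ≠ 0 := by rw [← norm_pos_iff, hl]; norm_num
  set ρ : ℝ := 1 / (2 * A) with hρ
  have hρ0 : 0 < ρ := by positivity
  have hu : Summable (fun n : ℕ => B * (1 / 2 : ℝ) ^ n) :=
    (summable_geometric_of_lt_one (by norm_num) (by norm_num)).mul_left B
  have hbd : ∀ (n : ℕ) (z : ℂ), z ∈ ball (0 : ℂ) ρ → ‖coef lam n * z ^ n‖ ≤ B * (1 / 2) ^ n := by
    intro n z hz
    rw [mem_ball_zero_iff] at hz
    rw [norm_mul, norm_pow]
    calc ‖coef lam n‖ * ‖z‖ ^ n ≤ (B * A ^ n) * ρ ^ n :=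
          mul_le_mul (hb n) (by gcongr) (by positivity) ((norm_nonneg _).trans (hb n))
      _ = _ := by
          rw [mul_assoc, ← mul_pow]; congr 2; rw [hρ]; field_simp
  have hs : ∀ z ∈ ball (0 : ℂ) ρ, Summable (fun n => ‖coef lam n * z ^ n‖) := fun z hz =>
    Summable.of_nonneg_of_le (fun _ => norm_nonneg _) (fun n => hbd n z hz) hu
  let g : ℂ → ℂ := fun z => ∑' n, coef lam n * z ^ n
  have hg : DifferentiableOn ℂ g (ball 0 ρ) :=
    Complex.differentiableOn_tsum_of_summable_norm hu
      (fun n => by fun_prop) isOpen_ball hbd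
  have hg0 : g 0 = 1 := by
    have : g 0 = coef lam 0 * 0 ^ 0 := tsum_eq_single 0 (fun n hn => by simp [hn])
    rw [this, coef_zero]; simp
  have hh : DifferentiableOn ℂ (fun z => z * g z) (ball 0 ρ) := differentiableOn_id.mul hg
  have hfun : ∀ z ∈ ball (0 : ℂ) ρ, z * (g z * g z) + lam * g z = lam * g (lam * z) := by
    intro z hz
    have hz' : lam * z ∈ ball (0 : ℂ) ρ := by
      rw [mem_ball_zero_iff] at hz ⊢; rwa [norm_mul, hl, one_mul]
    have s1 := hs z hz
    have s2 := (hs _ hz').of_norm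
    have e1 : g z = 1 + ∑' n, coef lam (n + 1) * z ^ (n + 1) := by
      have := s1.of_norm.tsum_eq_zero_add
      rw [show g z = _ from this, coef_zero]; simp
    have e2 : g (lam * z) = 1 + ∑' n, coef lam (n + 1) * (lam * z) ^ (n + 1) := by
      have := s2.tsum_eq_zero_add
      rw [show g (lam * z) = _ from this, coef_zero]; simp
    have e3 : g z * g z = ∑' n, ∑ p ∈ Finset.HasAntidiagonal.antidiagonal n,
        (coef lam p.1 * z ^ p.1) * (coef lam p.2 * z ^ p.2) :=
      tsum_mul_tsum_eq_tsum_sum_antidiagonal_of_summable_norm s1 s1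
    have t1 : Summable fun n => coef lam (n + 1) * z ^ (n + 1) :=
      (summable_nat_add_iff (f := fun n => coef lam n * z ^ n) 1).2 s1.of_norm
    have t2 : Summable fun n => coef lam (n + 1) * (lam * z) ^ (n + 1) :=
      (summable_nat_add_iff (f := fun n => coef lam n * (lam * z) ^ n) 1).2 s2
    have e4 : z * (g z * g z) = ∑' n, lam * (coef lam (n + 1) * (lam * z) ^ (n + 1) -
        coef lam (n + 1) * z ^ (n + 1)) := by
      rw [e3, ← tsum_mul_left]
      congr 1; ext n
      have h1 : ∑ p ∈ Finset.HasAntidiagonal.antidiagonal n,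
        (coef lam p.1 * z ^ p.1) * (coef lam p.2 * z ^ p.2) =
          z ^ n * ∑ p ∈ Finset.HasAntidiagonal.antidiagonal n, coef lam p.1 * coef lam p.2 := by
        rw [Finset.mul_sum]
        refine Finset.sum_congr rfl fun p hp => ?_
        rw [← Finset.HasAntidiagonal.mem_antidiagonal.1 hp, pow_add]; ring
      have h2 : lam * (lam ^ (n + 1) - 1) * coef lam (n + 1) =
          ∑ p ∈ Finset.HasAntidiagonal.antidiagonal n, coef lam p.1 * coef lam p.2 := by
        rw [coef_succ, mul_inv_cancel_left₀ (mul_ne_zero hl0 (hne _ (by omega)))]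
      rw [h1, ← h2, mul_pow]; ring
    rw [e4, tsum_mul_left, t2.tsum_sub t1, e1, e2]; ring
  have hder : HasStrictDerivAt (fun z => z * g z) 1 0 := by
    have hmem : ball (0 : ℂ) ρ ∈ nhds (0 : ℂ) := ball_mem_nhds _ hρ0
    have han : AnalyticAt ℂ (fun z => z * g z) 0 := hh.analyticAt hmem
    have h1 := han.hasStrictDerivAt
    have h2 : HasDerivAt (fun z => z * g z) (1 * g 0 + 0 * deriv g 0) 0 :=
      (hasDerivAt_id (0 : ℂ)).mul (hg.differentiableAt hmem).hasDerivAt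
    rw [h2.deriv, hg0] at h1
    simpa using h1
  have hinj : ∃ s ∈ nhds (0 : ℂ), Set.InjOn (fun z => z * g z) s := by
    have h3 := hder.hasStrictFDerivAt_equiv one_ne_zero
    refine ⟨_, (h3.toOpenPartialHomeomorph _).open_source.mem_nhds
      h3.mem_toOpenPartialHomeomorph_source, ?_⟩
    exact (h3.toOpenPartialHomeomorph _).injOn
  obtain ⟨s, hs0, hsi⟩ := hinj
  obtain ⟨δ, hδ, hδs⟩ := Metric.mem_nhds_iff.1 hs0
  refine ⟨min ρ δ, lt_min hρ0 hδ, fun z => z * g z, hh.mono (ball_subset_ball (min_le_left _ _)),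
    hsi.mono ((ball_subset_ball (min_le_right _ _)).trans hδs), by simp, fun z hz => ?_⟩
  have := hfun z (ball_subset_ball (min_le_left _ _) hz)
  linear_combination z * this

end SiegelQuad

/-- Siegel's linearization theorem for the quadratic family: if `α` satisfies a
Diophantine condition, then `P_α(z) = z² + e^{2πiα} z` is linearizable at `0`. -/
theorem siegel_linearization_quadratic
    (α : ℝ)
    (hdioph : ∃ c : ℝ, 0 < c ∧ ∃ τ : ℝ, 0 < τ ∧
      ∀ p : ℤ, ∀ q : ℕ, 1 ≤ q → c / (q : ℝ) ^ τ < |α - (p : ℝ) / (q : ℝ)|) :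
    ∃ r : ℝ, 0 < r ∧ ∃ h : ℂ → ℂ,
      DifferentiableOn ℂ h (ball (0 : ℂ) r) ∧
      Set.InjOn h (ball (0 : ℂ) r) ∧
      h 0 = 0 ∧
      ∀ z ∈ ball (0 : ℂ) r,
        (h z) ^ 2 + Complex.exp (2 * Real.pi * Complex.I * (α : ℂ)) * h z
          = h (Complex.exp (2 * Real.pi * Complex.I * (α : ℂ)) * z) := by
  obtain ⟨c, hc, τ, _, h⟩ := hdioph
  have hl : ‖Complex.exp (2 * Real.pi * Complex.I * (α : ℂ))‖ = 1 := by
    rw [show (2 * Real.pi * Complex.I * (α : ℂ)) = ((2 * Real.pi * α : ℝ) : ℂ) * Complex.I by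
      push_cast; ring]
    exact Complex.norm_exp_ofReal_mul_I _
  have hsd := fun k hk => SiegelQuad.small_div α c τ hc k hk h
  obtain ⟨A, hA, B, _, hb⟩ := SiegelQuad.coef_bound _ hl c⁻¹ (inv_pos.2 hc) _ hsd
  refine SiegelQuad.finish _ hl (fun k hk h0 => ?_) A B hA hb
  have := hsd k hk
  rw [h0] at this
  norm_num at this
end
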